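/- arXiv:2404.00248 — 2 statements merged into one kernel-verified Lean document; each statement's English description precedes it below -/
import Mathlib

section
/- Let 0 < β < 1 and let f : [0,∞) → ℝ be given by an everywhere-convergent power series f(s) = ∑_{n=0}^∞ c_n s^n / n! whose coefficients satisfy |c_n| ≤ C M^n for some constants C, M > 0 (so c_n = f^{(n)}(0)). Then for every t > 0 the Wright-type transform of f has the convergent series expansion f_β(t) = ∑_{n=0}^∞ c_n · t^{nβ} / Γ(nβ + 1). -/
open MeasureTheory Real Set Filter

/-- The Wright-type density `g_β(x;t) = t^{-β} ∑_{k} (−x/t^β)^k / (k! Γ(1 − β(k+1)))`. -/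
noncomputable def wrightG (β x t : ℝ) : ℝ :=
  t ^ (-β) * ∑' k : ℕ, (-x / t ^ β) ^ k / ((Nat.factorial k : ℝ) * Real.Gamma (1 - β * (k + 1)))

/-- The two-parameter Mittag-Leffler function `E_{β,α}(z) = ∑_k z^k / Γ(βk + α)`. -/
noncomputable def mittagLeffler (β α z : ℝ) : ℝ :=
  ∑' k : ℕ, z ^ k / Real.Gamma (β * k + α)

/-- The Caputo fractional derivative of order `β ∈ (0,1)`:
`D_c^β h(t) = (1/Γ(1−β)) ∫_0^t (t−τ)^{−β} h′(τ) dτ`. -/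
noncomputable def caputo (β : ℝ) (h : ℝ → ℝ) (t : ℝ) : ℝ :=
  (1 / Real.Gamma (1 - β)) * ∫ τ in (0:ℝ)..t, (t - τ) ^ (-β) * deriv h τ

/-- A function is of exponential order on `[0,∞)` if `|h(x)| ≤ C e^{a x}` there. -/
def ExpOrder (h : ℝ → ℝ) : Prop :=
  ∃ C a : ℝ, 0 < C ∧ 0 < a ∧ ∀ x : ℝ, 0 ≤ x → |h x| ≤ C * Real.exp (a * x)

theorem eventually_rpow_mul_exp_rpow_le {β : ℝ} (hβ : β < 1) (p x : ℝ) {δ : ℝ} (hδ : 0 < δ) :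
    ∀ᶠ ρ : ℝ in atTop, ρ ^ p * exp (x * ρ ^ β) ≤ exp (δ * ρ) := by
  have h1 := (isLittleO_rpow_exp_pos_mul_atTop p (half_pos hδ)).bound one_pos
  have h2 : Tendsto (fun ρ : ℝ => x * ρ ^ (-(1 - β))) atTop (nhds (x * 0)) :=
    (tendsto_rpow_neg_atTop (by linarith : 0 < 1 - β)).const_mul x
  rw [mul_zero] at h2
  filter_upwards [h1, h2.eventually (gt_mem_nhds (half_pos hδ)), eventually_gt_atTop 0]
    with ρ h1 h2 h3
  rw [Real.norm_of_nonneg (by positivity), Real.norm_of_nonneg (by positivity), one_mul] at h1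
  have h4 : x * ρ ^ β ≤ δ / 2 * ρ := by
    have : ρ ^ β = ρ ^ (-(1 - β)) * ρ := by
      rw [← rpow_add_one h3.ne']; ring_nf
    rw [this, ← mul_assoc]
    exact mul_le_mul_of_nonneg_right h2.le h3.le
  calc ρ ^ p * exp (x * ρ ^ β) ≤ exp (δ / 2 * ρ) * exp (δ / 2 * ρ) := by gcongr
    _ = exp (δ * ρ) := by rw [← Real.exp_add]; ring_nf

theorem integrableOn_exp_mul_rpow_mul_exp_rpow {β δ A : ℝ} (hβ : β < 1) (hδ : 0 < δ)
    (p x : ℝ) {ρ : ℝ → ℝ} (hc : ContinuousOn ρ (Ici 0)) (hpos : ∀ r, 0 ≤ r → 0 < ρ r)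
    (hle : ∀ r, 0 ≤ r → ρ r ≤ A + r) (htop : Tendsto ρ atTop atTop) :
    IntegrableOn (fun r => exp (-δ * r) * (ρ r ^ p * exp (x * ρ r ^ β))) (Ioi 0) := by
  have hne : ∀ r ∈ Ici (0 : ℝ), ρ r ≠ 0 := fun r hr => (hpos r hr).ne'
  refine integrable_of_isBigO_exp_neg (half_pos hδ) ?_ ?_
  · have h1 : ∀ q : ℝ, ContinuousOn (fun r => ρ r ^ q) (Ici 0) := fun q =>
      hc.rpow_const fun r hr => Or.inl (hne r hr)
    exact (by fun_prop : ContinuousOn (fun r : ℝ => exp (-δ * r)) (Ici 0)).mul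
      ((h1 p).mul (continuousOn_const.mul (h1 β)).rexp)
  · refine Asymptotics.IsBigO.of_bound (exp (δ / 2 * A)) ?_
    filter_upwards [htop.eventually (eventually_rpow_mul_exp_rpow_le hβ p x (half_pos hδ)),
      eventually_ge_atTop 0] with r h1 h2
    have h3 := hpos r h2
    rw [Real.norm_of_nonneg (by positivity), Real.norm_of_nonneg (by positivity)]
    calc _ ≤ exp (-δ * r) * exp (δ / 2 * ρ r) := by gcongr
      _ ≤ exp (-δ * r) * exp (δ / 2 * (A + r)) := by gcongr; exact hle r h2
      _ = _ := by rw [← Real.exp_add, ← Real.exp_add]; ring_nf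

/-- The point at distance `r` from `a` on the ray from `a` of direction `e^{iθ}`. -/
noncomputable def rayPoint (θ a r : ℝ) : ℂ := a + r * Complex.exp (θ * Complex.I)

theorem rayPoint_re (θ a r : ℝ) : (rayPoint θ a r).re = a + r * cos θ := by
  simp [rayPoint, Complex.exp_ofReal_mul_I_re]

theorem rayPoint_im (θ a r : ℝ) : (rayPoint θ a r).im = r * sin θ := by
  simp [rayPoint, Complex.exp_ofReal_mul_I_im]

theorem rayPoint_norm_le {θ a r : ℝ} (ha : 0 ≤ a) (hr : 0 ≤ r) : ‖rayPoint θ a r‖ ≤ a + r := by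
  refine (norm_add_le _ _).trans ?_
  simp [Complex.norm_exp_ofReal_mul_I, abs_of_nonneg ha, abs_of_nonneg hr]

theorem le_rayPoint_norm (θ a r : ℝ) : r - |a| ≤ ‖rayPoint θ a r‖ := by
  have h := norm_sub_norm_le (r * Complex.exp (θ * Complex.I)) (-(a : ℂ))
  simp only [norm_mul, Complex.norm_exp_ofReal_mul_I, mul_one, norm_neg, Complex.norm_real,
    Real.norm_eq_abs, sub_neg_eq_add] at h
  rw [rayPoint, add_comm]
  linarith [le_abs_self r]

theorem rayPoint_mem_slitPlane {θ a r : ℝ} (h : 0 < sin θ) (hr : 0 ≤ r)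
    (har : 0 < a + r) : rayPoint θ a r ∈ Complex.slitPlane := by
  rw [Complex.mem_slitPlane_iff, rayPoint_re, rayPoint_im]
  rcases hr.eq_or_lt with rfl | hr
  · left; simpa using har
  · right; positivity

theorem rayPoint_rotate_im (θ a r : ℝ) :
    (rayPoint θ a r * Complex.exp (-θ * Complex.I)).im = -(a * sin θ) := by
  have : rayPoint θ a r * Complex.exp (-θ * Complex.I)
      = a * Complex.exp ((-θ : ℝ) * Complex.I) + r := by
    rw [rayPoint, add_mul, mul_assoc, ← Complex.exp_add]; simp
  rw [this]
  simp only [Complex.add_im, Complex.im_ofReal_mul, Complex.exp_ofReal_mul_I_im, Complex.ofReal_im]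
  simp

theorem mul_sin_le_rayPoint_norm (θ a r : ℝ) : a * sin θ ≤ ‖rayPoint θ a r‖ := by
  have h := Complex.abs_im_le_norm (rayPoint θ a r * Complex.exp (-θ * Complex.I))
  rw [rayPoint_rotate_im, norm_mul, abs_neg, ← Complex.ofReal_neg,
    Complex.norm_exp_ofReal_mul_I, mul_one] at h
  exact (le_abs_self _).trans h

theorem rayPoint_arg_mem {θ a r : ℝ} (h0 : 0 < θ) (hπ : θ < π) (ha : 0 < a) (hr : 0 ≤ r) :
    0 ≤ (rayPoint θ a r).arg ∧ (rayPoint θ a r).arg ≤ θ := by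
  have hs := sin_pos_of_pos_of_lt_pi h0 hπ
  refine ⟨Complex.arg_nonneg_iff.2 (by rw [rayPoint_im]; positivity), ?_⟩
  by_contra! h
  have h1 := rayPoint_rotate_im θ a r
  rw [← Complex.norm_mul_exp_arg_mul_I (rayPoint θ a r), mul_assoc, ← Complex.exp_add,
    ← add_mul, ← Complex.ofReal_neg, ← Complex.ofReal_add, Complex.im_ofReal_mul,
    Complex.exp_ofReal_mul_I_im] at h1
  have h2 : 0 ≤ sin ((rayPoint θ a r).arg + -θ) :=
    sin_nonneg_of_nonneg_of_le_pi (by linarith) (by linarith [Complex.arg_le_pi (rayPoint θ a r)])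
  have h3 : 0 ≤ ‖rayPoint θ a r‖ * sin ((rayPoint θ a r).arg + -θ) := by positivity
  nlinarith [mul_pos ha hs]

theorem le_rayPoint_cpow_re {θ a r β : ℝ} (h0 : 0 < θ) (hπ : θ < π) (ha : 0 < a) (hr : 0 ≤ r)
    (hβ : 0 < β) (hβθ : β * θ < π / 2) :
    (a * sin θ) ^ β * cos (β * θ) ≤ (rayPoint θ a r ^ (β : ℂ)).re := by
  have hs := sin_pos_of_pos_of_lt_pi h0 hπ
  have hn := mul_sin_le_rayPoint_norm θ a r
  have hpos : 0 < ‖rayPoint θ a r‖ := lt_of_lt_of_le (by positivity) hn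
  obtain ⟨h1, h2⟩ := rayPoint_arg_mem h0 hπ ha hr
  rw [Complex.cpow_ofReal_re, mul_comm (Complex.arg _)]
  have h3 : 0 ≤ cos (β * θ) :=
    cos_nonneg_of_neg_pi_div_two_le_of_le (by nlinarith [pi_pos]) hβθ.le
  gcongr
  exact cos_le_cos_of_nonneg_of_le_pi (by positivity) (by linarith [pi_pos]) (by gcongr)

theorem integrableOn_rpow_mul_exp_neg_mul {v δ : ℝ} (hv : -1 < v) (hδ : 0 < δ) :
    IntegrableOn (fun r : ℝ => r ^ v * exp (-δ * r)) (Ioi 0) := by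
  simpa using integrableOn_rpow_mul_exp_neg_mul_rpow hv one_pos hδ

theorem Complex.norm_exp_ofReal_mul_exp_mul_I (r θ : ℝ) :
    ‖Complex.exp (r * Complex.exp (θ * Complex.I))‖ = Real.exp (Real.cos θ * r) := by
  rw [Complex.norm_exp, Complex.re_ofReal_mul, Complex.exp_ofReal_mul_I_re, mul_comm]

/-- The Gamma integral along the ray of direction `e^{i(π-θ)}`. -/
theorem integral_rotated_Gamma {θ v : ℝ} (hv : 0 < v) (h1 : π / 2 < θ) (h2 : θ < π) :
    ∫ r in Ioi (0 : ℝ), Complex.exp (((1 + v : ℝ) : ℂ) * (θ * Complex.I)) *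
        ((r ^ v : ℝ) * Complex.exp (r * Complex.exp (θ * Complex.I)))
      = Complex.exp (((1 + v : ℝ) : ℂ) * (π * Complex.I)) * Real.Gamma (1 + v) := by
  set F : ℝ → ℝ → ℂ := fun θ r => Complex.exp (((1 + v : ℝ) : ℂ) * (θ * Complex.I)) *
        ((r ^ v : ℝ) * Complex.exp (r * Complex.exp (θ * Complex.I))) with hF
  set F' : ℝ → ℝ → ℂ := fun θ r =>
    ((1 + v : ℝ) * Complex.I + r * (Complex.exp (θ * Complex.I) * Complex.I)) * F θ r with hF'
  have hnorm : ∀ θ : ℝ, ∀ r : ℝ, 0 < r → ‖F θ r‖ = r ^ v * exp (cos θ * r) := by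
    intro θ r hr
    rw [hF]
    simp only
    rw [norm_mul, norm_mul, Complex.norm_exp_ofReal_mul_exp_mul_I,
      ← mul_assoc ((1 + v : ℝ) : ℂ),
      ← Complex.ofReal_mul, Complex.norm_exp_ofReal_mul_I, one_mul, Complex.norm_real,
      Real.norm_of_nonneg (by positivity)]
  have hnorm' : ∀ θ : ℝ, ∀ r : ℝ, 0 < r → ‖F' θ r‖ ≤
      (1 + v) * (r ^ v * exp (cos θ * r)) + r ^ (v + 1) * exp (cos θ * r) := by
    intro θ r hr
    rw [hF']
    simp only
    rw [norm_mul, hnorm θ r hr]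
    have : ‖((1 + v : ℝ) : ℂ) * Complex.I + r * (Complex.exp (θ * Complex.I) * Complex.I)‖
        ≤ (1 + v) + r := by
      refine (norm_add_le _ _).trans ?_
      rw [norm_mul, norm_mul, norm_mul, Complex.norm_exp_ofReal_mul_I, Complex.norm_I,
        Complex.norm_real, Complex.norm_real, Real.norm_of_nonneg (by positivity),
        Real.norm_of_nonneg hr.le]
      simp
    calc _ ≤ ((1 + v) + r) * (r ^ v * exp (cos θ * r)) := by gcongr
      _ = _ := by rw [rpow_add_one hr.ne']; ring
  have hcont : ∀ θ, Continuous (F θ) := by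
    intro θ
    have : Continuous fun r : ℝ => r ^ v := continuous_id.rpow_const fun _ => Or.inr hv.le
    simp only [hF]
    fun_prop
  have hcont' : ∀ θ, Continuous (F' θ) := by
    intro θ
    have := hcont θ
    simp only [hF']
    fun_prop
  have hint : ∀ θ : ℝ, cos θ < 0 → IntegrableOn (F θ) (Ioi 0) := by
    intro θ hθ
    have := integrableOn_rpow_mul_exp_neg_mul (v := v) (by linarith) (neg_pos.2 hθ)
    rw [neg_neg] at this
    refine this.mono' (hcont θ).aestronglyMeasurable ?_
    exact (ae_restrict_mem measurableSet_Ioi).mono fun r hr => (hnorm θ r hr).le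
  have hbint : ∀ δ : ℝ, δ < 0 → IntegrableOn
      (fun r : ℝ => (1 + v) * (r ^ v * exp (δ * r)) + r ^ (v + 1) * exp (δ * r)) (Ioi 0) := by
    intro δ hδ
    have h3 := integrableOn_rpow_mul_exp_neg_mul (v := v) (by linarith) (neg_pos.2 hδ)
    have h4 := integrableOn_rpow_mul_exp_neg_mul (v := v + 1) (by linarith) (neg_pos.2 hδ)
    rw [neg_neg] at h3 h4
    exact (h3.const_mul _).add h4
  have hint' : ∀ θ : ℝ, cos θ < 0 → IntegrableOn (F' θ) (Ioi 0) := by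
    intro θ hθ
    refine (hbint _ hθ).mono' (hcont' θ).aestronglyMeasurable ?_
    exact (ae_restrict_mem measurableSet_Ioi).mono fun r hr => hnorm' θ r hr
  have hzero : ∀ θ : ℝ, cos θ < 0 → ∫ r in Ioi (0 : ℝ), F' θ r = 0 := by
    intro θ hθ
    set G : ℝ → ℂ := fun r => r * Complex.I * F θ r with hG
    have hd : ∀ r ∈ Ioi (0 : ℝ), HasDerivAt G (F' θ r) r := by
      intro r hr
      have hr0 : r ≠ 0 := (mem_Ioi.1 hr).ne'
      have e1 : HasDerivAt (fun r : ℝ => ((r ^ v : ℝ) : ℂ)) ((v * r ^ (v - 1) : ℝ) : ℂ) r :=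
        (Real.hasDerivAt_rpow_const (Or.inl hr0)).ofReal_comp
      have e2 : HasDerivAt (fun r : ℝ => (r : ℂ)) 1 r := by
        simpa using (hasDerivAt_id r).ofReal_comp
      have e3 := (e2.mul_const (Complex.exp (θ * Complex.I))).cexp
      have e4 := (e2.mul_const Complex.I).mul
        ((e1.mul e3).const_mul (Complex.exp (((1 + v : ℝ) : ℂ) * (θ * Complex.I))))
      refine e4.congr_deriv ?_
      simp only [hF', hF, Pi.mul_apply, rpow_sub_one hr0]
      have : (r : ℂ) ≠ 0 := by exact_mod_cast hr0
      push_cast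
      field_simp
      ring
    have hGint : IntegrableOn G (Ioi 0) := by
      refine (hbint _ hθ).mono' (by have := hcont θ; exact
        (by fun_prop : Continuous G).aestronglyMeasurable) ?_
      refine (ae_restrict_mem measurableSet_Ioi).mono fun r hr => ?_
      have hr : 0 < r := hr
      simp only [hG]
      rw [norm_mul, hnorm θ r hr, norm_mul, Complex.norm_I, mul_one, Complex.norm_real,
        Real.norm_of_nonneg hr.le, rpow_add_one hr.ne']
      have : 0 ≤ (1 + v) * (r ^ v * exp (cos θ * r)) := by positivity
      nlinarith
    have ht := tendsto_zero_of_hasDerivAt_of_integrableOn_Ioi hd (hint' θ hθ) hGint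
    have hGc : Continuous G := by have := hcont θ; fun_prop
    rw [integral_Ioi_of_hasDerivAt_of_tendsto hGc.continuousWithinAt hd (hint' θ hθ) ht]
    simp [hG]
  have hderiv : ∀ θ : ℝ, cos θ < 0 →
      HasDerivAt (fun θ => ∫ r in Ioi (0 : ℝ), F θ r) 0 θ := by
    intro θ₀ hθ
    have hs : {θ : ℝ | cos θ < cos θ₀ / 2} ∈ nhds θ₀ :=
      (isOpen_lt continuous_cos continuous_const).mem_nhds (by simp only [mem_ofPred_eq]; linarith)
    have := (hasDerivAt_integral_of_dominated_loc_of_deriv_le (μ := volume.restrict (Ioi 0))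
      (F := F) (F' := F') hs
      (Eventually.of_forall fun θ => (hcont θ).aestronglyMeasurable) (hint _ hθ)
      (hcont' _).aestronglyMeasurable ?_ (hbint (cos θ₀ / 2) (by linarith)) ?_).2
    · rwa [hzero _ hθ] at this
    · refine (ae_restrict_mem measurableSet_Ioi).mono fun r hr θ hs => (hnorm' θ r hr).trans ?_
      have hr : 0 < r := hr
      have hs : cos θ ≤ cos θ₀ / 2 := le_of_lt hs
      gcongr
    · refine Eventually.of_forall fun r θ _ => ?_
      have e2 : HasDerivAt (fun r : ℝ => (r : ℂ)) 1 θ := by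
        simpa using (hasDerivAt_id θ).ofReal_comp
      have e3 := e2.mul_const Complex.I
      have e4 := (e3.const_mul ((1 + v : ℝ) : ℂ)).cexp.mul
        (((e3.cexp).const_mul (r : ℂ)).cexp.const_mul ((r ^ v : ℝ) : ℂ))
      refine e4.congr_deriv ?_
      simp only [hF', hF]
      ring
  have hcos : ∀ θ ∈ Ioo (π / 2) (3 * π / 2), cos θ < 0 := fun θ hθ =>
    cos_neg_of_pi_div_two_lt_of_lt hθ.1 (by linarith [hθ.2])
  have hconst := isOpen_Ioo.is_const_of_deriv_eq_zero (s := Ioo (π / 2) (3 * π / 2))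
    isPreconnected_Ioo
    (fun θ hθ => (hderiv θ (hcos θ hθ)).differentiableAt.differentiableWithinAt)
    (fun θ hθ => (hderiv θ (hcos θ hθ)).deriv)
    (show θ ∈ Ioo (π / 2) (3 * π / 2) from ⟨h1, by linarith [pi_pos]⟩)
    (show π ∈ Ioo (π / 2) (3 * π / 2) from ⟨by linarith [pi_pos], by linarith [pi_pos]⟩)
  refine hconst.trans ?_
  simp only [hF]
  rw [integral_const_mul, Complex.exp_pi_mul_I]
  congr 1
  rw [Real.Gamma_eq_integral (by linarith), ← integral_complex_ofReal]
  refine setIntegral_congr_fun measurableSet_Ioi fun r _ => ?_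
  simp [mul_comm]

theorem rayPoint_hasDerivAt (θ a r : ℝ) :
    HasDerivAt (rayPoint θ a) (Complex.exp (θ * Complex.I)) r := by
  have : HasDerivAt (fun r : ℝ => (r : ℂ)) 1 r := by simpa using (hasDerivAt_id r).ofReal_comp
  exact ((this.mul_const (Complex.exp (θ * Complex.I))).const_add (a : ℂ)).congr_deriv (one_mul _)

theorem rayPoint_hasDerivAt_base (θ a r : ℝ) : HasDerivAt (fun a => rayPoint θ a r) 1 a := by
  have : HasDerivAt (fun r : ℝ => (r : ℂ)) 1 a := by simpa using (hasDerivAt_id a).ofReal_comp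
  simpa [rayPoint] using this.add_const (r * Complex.exp (θ * Complex.I))

theorem tendsto_rayPoint_norm_atTop (θ a : ℝ) :
    Tendsto (fun r => ‖rayPoint θ a r‖) atTop atTop :=
  tendsto_atTop_mono (le_rayPoint_norm θ a) (tendsto_atTop_add_const_right _ _ tendsto_id)

theorem continuous_rayPoint (θ a : ℝ) : Continuous (rayPoint θ a) :=
  continuous_iff_continuousAt.2 fun r => (rayPoint_hasDerivAt θ a r).continuousAt

theorem Complex.norm_exp_mul_cpow_rayPoint (θ a r q : ℝ) :
    ‖Complex.exp (rayPoint θ a r) * rayPoint θ a r ^ (q : ℂ)‖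
      = Real.exp a * (Real.exp (Real.cos θ * r) * ‖rayPoint θ a r‖ ^ q) := by
  rw [norm_mul, Complex.norm_exp, Complex.norm_cpow_real, rayPoint_re, Real.exp_add, mul_assoc,
    mul_comm r]

theorem continuousOn_exp_mul_cpow_rayPoint {θ a : ℝ} (hθ : 0 < sin θ) (ha : 0 < a) (q : ℝ) :
    ContinuousOn (fun r => Complex.exp (rayPoint θ a r) * rayPoint θ a r ^ (q : ℂ)) (Ici 0) :=
  (continuous_rayPoint θ a).cexp.continuousOn.mul <|
    (continuous_rayPoint θ a).continuousOn.cpow_const fun _ hr =>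
      rayPoint_mem_slitPlane hθ hr (by have := mem_Ici.1 hr; positivity)

theorem integrableOn_norm_rayPoint {θ a β : ℝ} (hθ : 0 < sin θ) (hc : cos θ < 0) (ha : 0 < a)
    (hβ : β < 1) (q x : ℝ) :
    IntegrableOn (fun r => exp a * (exp (cos θ * r) * (‖rayPoint θ a r‖ ^ q *
      exp (x * ‖rayPoint θ a r‖ ^ β)))) (Ioi 0) := by
  have := integrableOn_exp_mul_rpow_mul_exp_rpow hβ (neg_pos.2 hc) q x
    (continuous_rayPoint θ a).norm.continuousOn
    (fun r _ => (mul_pos ha hθ).trans_le (mul_sin_le_rayPoint_norm θ a r))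
    (fun r hr => rayPoint_norm_le ha.le hr) (tendsto_rayPoint_norm_atTop θ a)
  rw [neg_neg] at this
  exact this.const_mul _

theorem integrableOn_exp_mul_cpow_rayPoint {θ a : ℝ} (hθ : 0 < sin θ) (hc : cos θ < 0)
    (ha : 0 < a) (q : ℝ) :
    IntegrableOn (fun r => Complex.exp (rayPoint θ a r) * rayPoint θ a r ^ (q : ℂ)) (Ioi 0) := by
  have := integrableOn_norm_rayPoint hθ hc ha zero_lt_one q 0
  simp only [zero_mul, exp_zero, mul_one] at this
  exact this.mono' (((continuousOn_exp_mul_cpow_rayPoint hθ ha q).mono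
    Ioi_subset_Ici_self).aestronglyMeasurable measurableSet_Ioi)
    (Eventually.of_forall fun r => (Complex.norm_exp_mul_cpow_rayPoint θ a r q).le)

/-- The integral of `e^ζ ζ^q` along the ray from `a` of direction `e^{iθ}`, which is the upper half
of a Hankel contour. -/
noncomputable def rayIntegral (θ a q : ℝ) : ℂ :=
  ∫ r in Ioi (0 : ℝ), Complex.exp (θ * Complex.I) *
    (Complex.exp (rayPoint θ a r) * rayPoint θ a r ^ (q : ℂ))

theorem hasDerivAt_exp_mul_cpow {z : ℂ} (hz : z ∈ Complex.slitPlane) (q : ℝ) :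
    HasDerivAt (fun z => Complex.exp z * z ^ (q : ℂ))
      (Complex.exp z * z ^ (q : ℂ) + q * (Complex.exp z * z ^ ((q - 1 : ℝ) : ℂ))) z := by
  refine ((Complex.hasDerivAt_exp z).mul ((hasDerivAt_id z).cpow_const hz)).congr_deriv ?_
  simp only [id, Complex.ofReal_sub, Complex.ofReal_one]
  ring

theorem integral_rayPoint_deriv {θ a : ℝ} (hθ : 0 < sin θ) (hc : cos θ < 0) (ha : 0 < a) (q : ℝ) :
    ∫ r in Ioi (0 : ℝ), Complex.exp (θ * Complex.I) *
      (Complex.exp (rayPoint θ a r) * rayPoint θ a r ^ (q : ℂ) +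
        q * (Complex.exp (rayPoint θ a r) * rayPoint θ a r ^ ((q - 1 : ℝ) : ℂ)))
      = ((-(exp a * a ^ q) : ℝ) : ℂ) := by
  have hd : ∀ r ∈ Ici (0 : ℝ), HasDerivAt
      (fun r => Complex.exp (rayPoint θ a r) * rayPoint θ a r ^ (q : ℂ))
      (Complex.exp (θ * Complex.I) *
      (Complex.exp (rayPoint θ a r) * rayPoint θ a r ^ (q : ℂ) +
        q * (Complex.exp (rayPoint θ a r) * rayPoint θ a r ^ ((q - 1 : ℝ) : ℂ)))) r := by
    intro r hr
    have := (hasDerivAt_exp_mul_cpow (rayPoint_mem_slitPlane (a := a) hθ hr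
      (by have := mem_Ici.1 hr; positivity)) q).comp r (rayPoint_hasDerivAt θ a r)
    exact this.congr_deriv (mul_comm _ _)
  have h1 := integrableOn_exp_mul_cpow_rayPoint hθ hc ha q
  have h2 : IntegrableOn (fun r : ℝ => Complex.exp (θ * Complex.I) *
      (Complex.exp (rayPoint θ a r) * rayPoint θ a r ^ (q : ℂ) +
        q * (Complex.exp (rayPoint θ a r) * rayPoint θ a r ^ ((q - 1 : ℝ) : ℂ)))) (Ioi 0) :=
    (h1.add ((integrableOn_exp_mul_cpow_rayPoint hθ hc ha (q - 1)).const_mul _)).const_mul _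
  have h3 := tendsto_zero_of_hasDerivAt_of_integrableOn_Ioi
    (fun r hr => hd r (Ioi_subset_Ici_self hr)) h2 h1
  rw [integral_Ioi_of_hasDerivAt_of_tendsto' hd h2 h3]
  simp [rayPoint, Complex.ofReal_cpow ha.le]

theorem rayIntegral_add_mul {θ a : ℝ} (hθ : 0 < sin θ) (hc : cos θ < 0) (ha : 0 < a) (q : ℝ) :
    rayIntegral θ a q + q * rayIntegral θ a (q - 1) = ((-(exp a * a ^ q) : ℝ) : ℂ) := by
  rw [← integral_rayPoint_deriv hθ hc ha q, rayIntegral, rayIntegral, ← integral_const_mul,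
    ← integral_add]
  · congr 1; ext r; ring
  · exact (integrableOn_exp_mul_cpow_rayPoint hθ hc ha q).const_mul _
  · exact ((integrableOn_exp_mul_cpow_rayPoint hθ hc ha (q - 1)).const_mul _).const_mul _

theorem rayIntegral_zero {θ q : ℝ} (hq : 0 < q) (h1 : π / 2 < θ) (h2 : θ < π) :
    rayIntegral θ 0 q = Complex.exp (((1 + q : ℝ) : ℂ) * (π * Complex.I)) * Real.Gamma (1 + q) := by
  rw [← integral_rotated_Gamma hq h1 h2, rayIntegral]
  refine setIntegral_congr_fun measurableSet_Ioi fun r hr => ?_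
  have hr : 0 < r := hr
  have h3 : (r * Complex.exp (θ * Complex.I)) ^ (q : ℂ)
      = ((r ^ q : ℝ) : ℂ) * Complex.exp (q * (θ * Complex.I)) := by
    rw [Complex.cpow_def_of_ne_zero (by simp [hr.ne']), Complex.log_ofReal_mul hr (by simp),
      Complex.log_exp (by simp; linarith [pi_pos]) (by simpa using h2.le), add_mul,
      Complex.exp_add, Real.rpow_def_of_pos hr]
    push_cast
    ring_nf
  simp only [rayPoint, Complex.ofReal_zero, zero_add]
  rw [h3]
  push_cast
  rw [add_mul, Complex.exp_add, one_mul]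
  ring

theorem Real.sin_mul_Gamma_eq_pi_mul_inv_Gamma_neg {q : ℝ} (hq : 0 < q) :
    Real.sin ((1 + q) * π) * Real.Gamma (1 + q) = π * (Real.Gamma (-q))⁻¹ := by
  have h := Real.Gamma_mul_Gamma_one_sub (-q)
  rw [sub_neg_eq_add, mul_neg, Real.sin_neg] at h
  have h3 : Real.sin ((1 + q) * π) = -Real.sin (π * q) := by
    rw [show (1 + q) * π = π * q + π by ring, Real.sin_add_pi]
  have hG : Real.Gamma (1 + q) ≠ 0 := (Real.Gamma_pos_of_pos (by linarith)).ne'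
  rw [h3]
  by_cases hs : Real.sin (π * q) = 0
  · rw [hs, neg_zero, div_zero] at h
    rw [hs, (mul_eq_zero.1 h).resolve_right hG]
    simp
  · have h4 : Real.Gamma (-q) ≠ 0 := by
      intro h4
      rw [h4, zero_mul] at h
      exact (div_ne_zero pi_ne_zero (neg_ne_zero.2 hs)) h.symm
    rw [eq_div_iff (neg_ne_zero.2 hs)] at h
    rw [eq_mul_inv_iff_mul_eq₀ h4]
    linarith

theorem rayIntegral_im_eq_zero_base {θ a q : ℝ} (h1 : π / 2 < θ) (h2 : θ < π) (ha : 0 < a)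
    (hq : 1 < q) : (rayIntegral θ a q).im = (rayIntegral θ 0 q).im := by
  have hθ : 0 < sin θ := sin_pos_of_pos_of_lt_pi (by linarith [pi_pos]) h2
  have hc : cos θ < 0 := cos_neg_of_pi_div_two_lt_of_lt h1 (by linarith [pi_pos])
  have hb : ∀ p : ℝ, IntegrableOn (fun r => exp a * (exp (cos θ * r) * (a + r) ^ p)) (Ioi 0) := by
    intro p
    have := integrableOn_exp_mul_rpow_mul_exp_rpow zero_lt_one (neg_pos.2 hc) p 0
      (ρ := fun r => a + r) (by fun_prop) (fun r hr => by positivity) (fun r _ => le_rfl)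
      (tendsto_atTop_add_const_left _ _ tendsto_id)
    simp only [neg_neg, zero_mul, exp_zero, mul_one] at this
    exact this.const_mul _
  have hle : ∀ p : ℝ, 0 ≤ p → ∀ r : ℝ, 0 < r → ∀ α ∈ Icc 0 a,
      ‖Complex.exp (rayPoint θ α r) * rayPoint θ α r ^ (p : ℂ)‖
        ≤ exp a * (exp (cos θ * r) * (a + r) ^ p) := by
    intro p hp r hr α hα
    rw [Complex.norm_exp_mul_cpow_rayPoint]
    have h3 := (rayPoint_norm_le (θ := θ) hα.1 hr.le).trans (add_le_add_left hα.2 r)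
    have := hα.2
    gcongr
  have hmeas : ∀ (p : ℝ), ∀ α ∈ Icc 0 a, AEStronglyMeasurable
      (fun r => Complex.exp (rayPoint θ α r) * rayPoint θ α r ^ (p : ℂ))
      (volume.restrict (Ioi 0)) := by
    intro p α hα
    refine ContinuousOn.aestronglyMeasurable ?_ measurableSet_Ioi
    exact (continuous_rayPoint θ α).cexp.continuousOn.mul <|
      (continuous_rayPoint θ α).continuousOn.cpow_const fun r hr =>
        rayPoint_mem_slitPlane hθ (mem_Ioi.1 hr).le (add_pos_of_nonneg_of_pos hα.1 hr)
  have hcpow : ∀ r : ℝ, 0 < r → ∀ α ∈ Icc 0 a, HasDerivAt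
      (fun α => Complex.exp (rayPoint θ α r) * rayPoint θ α r ^ (q : ℂ))
      (Complex.exp (rayPoint θ α r) * rayPoint θ α r ^ (q : ℂ) +
        q * (Complex.exp (rayPoint θ α r) * rayPoint θ α r ^ ((q - 1 : ℝ) : ℂ))) α := by
    intro r hr α hα
    have := (hasDerivAt_exp_mul_cpow (rayPoint_mem_slitPlane (a := α) hθ hr.le
      (add_pos_of_nonneg_of_pos hα.1 hr)) q).comp α (rayPoint_hasDerivAt_base θ α r)
    exact this.congr_deriv (mul_one _)
  have hcont : ContinuousOn (fun α => rayIntegral θ α q) (Icc 0 a) := by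
    refine continuousOn_of_dominated (fun α hα => (hmeas q α hα).const_mul _) (fun α hα => ?_)
      (hb q) ?_
    · refine (ae_restrict_mem measurableSet_Ioi).mono fun r hr => ?_
      rw [norm_mul, Complex.norm_exp_ofReal_mul_I, one_mul]
      exact hle q (by linarith) r hr α hα
    · refine (ae_restrict_mem measurableSet_Ioi).mono fun r hr α hα => ?_
      exact ((hcpow r hr α hα).const_mul _).continuousAt.continuousWithinAt
  have hderiv : ∀ α ∈ Ioo 0 a, HasDerivAt (fun α => (rayIntegral θ α q).im) 0 α := by
    intro α hα
    have hs : Ioo 0 a ∈ nhds α := isOpen_Ioo.mem_nhds hα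
    have h3 := (hasDerivAt_integral_of_dominated_loc_of_deriv_le (μ := volume.restrict (Ioi 0))
      (F := fun α r => Complex.exp (θ * Complex.I) *
        (Complex.exp (rayPoint θ α r) * rayPoint θ α r ^ (q : ℂ)))
      (F' := fun α r => Complex.exp (θ * Complex.I) *
        (Complex.exp (rayPoint θ α r) * rayPoint θ α r ^ (q : ℂ) +
        q * (Complex.exp (rayPoint θ α r) * rayPoint θ α r ^ ((q - 1 : ℝ) : ℂ)))) hs
      (eventually_of_mem hs fun α hα => (hmeas q α (Ioo_subset_Icc_self hα)).const_mul _)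
      ((integrableOn_exp_mul_cpow_rayPoint hθ hc hα.1 q).const_mul _)
      (((hmeas q α (Ioo_subset_Icc_self hα)).add
        ((hmeas (q - 1) α (Ioo_subset_Icc_self hα)).const_mul _)).const_mul _) ?_
      ((hb q).add ((hb (q - 1)).const_mul q)) ?_).2
    · rw [integral_rayPoint_deriv hθ hc hα.1] at h3
      have h4 := Complex.imCLM.hasFDerivAt.comp_hasDerivAt α h3
      exact h4.congr_deriv (by rw [Complex.imCLM_apply, Complex.ofReal_im])
    · refine (ae_restrict_mem measurableSet_Ioi).mono fun r hr α hα => ?_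
      have hα := Ioo_subset_Icc_self hα
      rw [norm_mul, Complex.norm_exp_ofReal_mul_I, one_mul]
      refine (norm_add_le _ _).trans ?_
      rw [norm_mul (q : ℂ), Complex.norm_real, Real.norm_of_nonneg (by linarith)]
      have h4 := hle q (by linarith) r hr α hα
      have h5 := hle (q - 1) (by linarith) r hr α hα
      exact add_le_add h4 (mul_le_mul_of_nonneg_left h5 (by linarith))
    · refine (ae_restrict_mem measurableSet_Ioi).mono fun r hr α hα => ?_
      exact (hcpow r hr α (Ioo_subset_Icc_self hα)).const_mul _
  obtain ⟨x, -, hx⟩ := exists_hasDerivAt_eq_slope (fun α => (rayIntegral θ α q).im)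
    (fun _ => 0) ha (Complex.continuous_im.comp_continuousOn hcont) hderiv
  rw [eq_comm, div_eq_zero_iff, sub_zero] at hx
  rcases hx with hx | hx
  · exact sub_eq_zero.1 hx
  · exact absurd hx ha.ne'

theorem continuous_rayIntegral {θ a : ℝ} (hθ : 0 < sin θ) (hc : cos θ < 0) (ha : 0 < a) :
    Continuous (rayIntegral θ a) := by
  have hpos : ∀ r, 0 < ‖rayPoint θ a r‖ := fun r =>
    (mul_pos ha hθ).trans_le (mul_sin_le_rayPoint_norm θ a r)
  have hint : ∀ p : ℝ, IntegrableOn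
      (fun r => exp a * (exp (cos θ * r) * ‖rayPoint θ a r‖ ^ p)) (Ioi 0) := by
    intro p
    simpa using integrableOn_norm_rayPoint hθ hc ha zero_lt_one p 0
  refine continuous_iff_continuousAt.2 fun q₀ => ?_
  have hs : Ioo (q₀ - 1) (q₀ + 1) ∈ nhds q₀ := isOpen_Ioo.mem_nhds (by simp)
  refine continuousAt_of_dominated (Eventually.of_forall fun q =>
    ((integrableOn_exp_mul_cpow_rayPoint hθ hc ha q).const_mul _).aestronglyMeasurable)
    (eventually_of_mem hs fun q hq => Eventually.of_forall fun r => ?_)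
    ((hint (q₀ - 1)).add (hint (q₀ + 1))) (Eventually.of_forall fun r => ?_)
  · rw [norm_mul, Complex.norm_exp_ofReal_mul_I, one_mul, Complex.norm_exp_mul_cpow_rayPoint,
      Pi.add_apply, ← mul_add, ← mul_add]
    gcongr
    rcases le_total 1 ‖rayPoint θ a r‖ with h | h
    · have := rpow_le_rpow_of_exponent_le h hq.2.le
      have := rpow_pos_of_pos (hpos r) (q₀ - 1)
      linarith
    · have := rpow_le_rpow_of_exponent_ge (hpos r) h hq.1.le
      have := rpow_pos_of_pos (hpos r) (q₀ + 1)
      linarith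
  · have := norm_pos_iff.1 (hpos r)
    have h : ContinuousAt (fun q : ℝ => rayPoint θ a r ^ (q : ℂ)) q₀ :=
      (Complex.continuous_ofReal.continuousAt).const_cpow (Or.inl this)
    exact continuousAt_const.mul (continuousAt_const.mul h)

theorem rayIntegral_im {θ a : ℝ} (h1 : π / 2 < θ) (h2 : θ < π) (ha : 0 < a) (q : ℝ) :
    (rayIntegral θ a q).im = π * (Real.Gamma (-q))⁻¹ := by
  have hθ : 0 < sin θ := sin_pos_of_pos_of_lt_pi (by linarith [pi_pos]) h2
  have hc : cos θ < 0 := cos_neg_of_pi_div_two_lt_of_lt h1 (by linarith [pi_pos])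
  have hbase : ∀ q : ℝ, 1 < q → (rayIntegral θ a q).im = π * (Real.Gamma (-q))⁻¹ := by
    intro q hq
    rw [rayIntegral_im_eq_zero_base h1 h2 ha hq, rayIntegral_zero (by linarith) h1 h2,
      ← Real.sin_mul_Gamma_eq_pi_mul_inv_Gamma_neg (by linarith), ← mul_assoc,
      ← Complex.ofReal_mul, Complex.im_mul_ofReal, Complex.exp_ofReal_mul_I_im]
  have hstep : ∀ q : ℝ, q + 1 ≠ 0 → (rayIntegral θ a (q + 1)).im = π * (Real.Gamma (-(q + 1)))⁻¹ →
      (rayIntegral θ a q).im = π * (Real.Gamma (-q))⁻¹ := by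
    intro q hq h
    have h3 := congrArg Complex.im (rayIntegral_add_mul hθ hc ha (q + 1))
    rw [Complex.add_im, Complex.im_ofReal_mul, Complex.ofReal_im, h, add_sub_cancel_right] at h3
    have h4 := Real.Gamma_add_one (neg_ne_zero.2 hq)
    rw [show -(q + 1) + 1 = -q by ring] at h4
    rw [h4, mul_inv, inv_neg]
    rw [← div_eq_mul_inv] at h3
    field_simp
    linarith
  have hpos : ∀ q : ℝ, 0 < q → (rayIntegral θ a q).im = π * (Real.Gamma (-q))⁻¹ := fun q hq =>
    hstep q (by linarith) (hbase _ (by linarith))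
  have hneg : ∀ q : ℝ, -1 < q → (rayIntegral θ a q).im = π * (Real.Gamma (-q))⁻¹ := fun q hq =>
    hstep q (by linarith) (hpos _ (by linarith))
  have hone : (rayIntegral θ a (-1)).im = π * (Real.Gamma (-(-1)))⁻¹ := by
    have h3 : Tendsto (fun q => (rayIntegral θ a q).im) (nhdsWithin (-1) (Ioi (-1)))
        (nhds (rayIntegral θ a (-1)).im) :=
      (Complex.continuous_im.comp
        (continuous_rayIntegral hθ hc ha)).continuousAt.tendsto.mono_left nhdsWithin_le_nhds
    have h4 : Tendsto (fun q : ℝ => π * (Real.Gamma (-q))⁻¹) (nhdsWithin (-1) (Ioi (-1)))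
        (nhds (π * (Real.Gamma (-(-1)))⁻¹)) := by
      have hG : ContinuousAt Real.Gamma (-(-1)) :=
        (Real.differentiableAt_Gamma fun m h => by
          have : (0 : ℝ) ≤ m := m.cast_nonneg
          linarith).continuousAt
      have : ContinuousAt (fun q : ℝ => π * (Real.Gamma (-q))⁻¹) (-1) :=
        continuousAt_const.mul ((hG.comp continuous_neg.continuousAt).inv₀
          (Real.Gamma_pos_of_pos (by norm_num)).ne')
      exact this.tendsto.mono_left nhdsWithin_le_nhds
    exact tendsto_nhds_unique_of_eventuallyEq h3 h4
      (eventually_of_mem self_mem_nhdsWithin fun q hq => hneg q hq)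
  have hall : ∀ n : ℕ, ∀ q : ℝ, -1 - (n : ℝ) ≤ q →
      (rayIntegral θ a q).im = π * (Real.Gamma (-q))⁻¹ := by
    intro n
    induction n with
    | zero =>
      intro q hq
      rcases hq.eq_or_lt with h | h
      · rw [← h]; simpa using hone
      · exact hneg q (by simpa using h)
    | succ n ih =>
      intro q hq
      push_cast at hq
      rcases eq_or_ne (q + 1) 0 with h | h
      · rw [eq_neg_of_add_eq_zero_left h]; exact hone
      · exact hstep q h (ih _ (by linarith))
  obtain ⟨n, hn⟩ := exists_nat_ge (-q - 1)
  exact hall n q (by linarith)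

theorem integral_pow_mul_cexp_neg_mul {q : ℂ} (hq : 0 < q.re) (n : ℕ) :
    ∫ s in Ioi (0 : ℝ), (s : ℂ) ^ n * Complex.exp (-(q * s)) = (n.factorial : ℂ) / q ^ (n + 1) := by
  have hq0 : q ≠ 0 := by rintro rfl; simp at hq
  have hint : ∀ n : ℕ, IntegrableOn (fun s : ℝ => (s : ℂ) ^ n * Complex.exp (-(q * s))) (Ioi 0) := by
    intro n
    have h := integrableOn_rpow_mul_exp_neg_mul (v := n)
      (by have := n.cast_nonneg (α := ℝ); linarith) hq
    refine h.mono' (by fun_prop) ((ae_restrict_mem measurableSet_Ioi).mono fun s hs => ?_)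
    rw [norm_mul, norm_pow, Complex.norm_real, Real.norm_of_nonneg (mem_Ioi.1 hs).le,
      Complex.norm_exp, Complex.neg_re, Complex.re_mul_ofReal, rpow_natCast, neg_mul]
  have hd : ∀ n : ℕ, ∀ s : ℝ, HasDerivAt (fun s : ℝ => (s : ℂ) ^ n * Complex.exp (-(q * s)))
      (n * (s : ℂ) ^ (n - 1) * Complex.exp (-(q * s)) -
        q * ((s : ℂ) ^ n * Complex.exp (-(q * s)))) s := by
    intro n s
    have e : HasDerivAt (fun s : ℝ => (s : ℂ)) 1 s := by simpa using (hasDerivAt_id s).ofReal_comp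
    refine ((e.pow n).mul (e.const_mul q).neg.cexp).congr_deriv ?_
    simp only [Pi.pow_apply, Pi.neg_apply]
    ring
  have hint' : ∀ n : ℕ, IntegrableOn (fun s : ℝ => n * (s : ℂ) ^ (n - 1) * Complex.exp (-(q * s)) -
        q * ((s : ℂ) ^ n * Complex.exp (-(q * s)))) (Ioi 0) := by
    intro n
    simp only [mul_assoc (n : ℂ)]
    exact ((hint (n - 1)).const_mul _).sub ((hint n).const_mul _)
  have hval : ∀ n : ℕ, ∫ s in Ioi (0 : ℝ), (n * (s : ℂ) ^ (n - 1) * Complex.exp (-(q * s)) -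
        q * ((s : ℂ) ^ n * Complex.exp (-(q * s)))) = -(0 : ℂ) ^ n := by
    intro n
    rw [integral_Ioi_of_hasDerivAt_of_tendsto' (fun s _ => hd n s) (hint' n)
      (tendsto_zero_of_hasDerivAt_of_integrableOn_Ioi (fun s _ => hd n s) (hint' n) (hint n))]
    simp
  have hrec : ∀ n : ℕ, n * (∫ s in Ioi (0 : ℝ), (s : ℂ) ^ (n - 1) * Complex.exp (-(q * s))) -
      q * (∫ s in Ioi (0 : ℝ), (s : ℂ) ^ n * Complex.exp (-(q * s))) = -(0 : ℂ) ^ n := by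
    intro n
    rw [← hval n, ← integral_const_mul, ← integral_const_mul, ← integral_sub
      ((hint (n - 1)).const_mul _) ((hint n).const_mul _)]
    simp only [mul_assoc]
  induction n with
  | zero =>
    have h := hrec 0
    simp only [Nat.cast_zero, zero_mul, zero_sub, pow_zero, neg_inj] at h
    rw [Nat.factorial_zero, Nat.cast_one, zero_add, pow_one, eq_div_iff hq0, mul_comm]
    simpa using h
  | succ n ih =>
    have h := hrec (n + 1)
    rw [Nat.add_sub_cancel, ih, zero_pow (Nat.succ_ne_zero n), neg_zero, sub_eq_zero] at h
    rw [pow_succ q (n + 1), Nat.factorial_succ]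
    push_cast at h ⊢
    field_simp at h ⊢
    linear_combination -h

theorem Real.hasSum_pow_div_factorial (x : ℝ) :
    HasSum (fun n : ℕ => x ^ n / (n.factorial : ℝ)) (Real.exp x) := by
  rw [Real.exp_eq_exp_ℝ]
  exact NormedSpace.expSeries_div_hasSum_exp x

theorem Complex.hasSum_pow_div_factorial (x : ℂ) :
    HasSum (fun n : ℕ => x ^ n / (n.factorial : ℂ)) (Complex.exp x) := by
  rw [Complex.exp_eq_exp_ℂ]
  exact NormedSpace.expSeries_div_hasSum_exp x

/-- The integrand of the Hankel-type representation of the Wright density, along the ray from `a`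
of direction `e^{iθ}`. -/
noncomputable def wrightKernel (θ a β x r : ℝ) : ℂ :=
  Complex.exp (θ * Complex.I) * (Complex.exp (rayPoint θ a r) * rayPoint θ a r ^ ((β - 1 : ℝ) : ℂ))
    * Complex.exp (-(x * rayPoint θ a r ^ (β : ℂ)))

theorem hasSum_wrightSeries {θ a β : ℝ} (h1 : π / 2 < θ) (h2 : θ < π) (ha : 0 < a)
    (hβ : β < 1) (x : ℝ) :
    HasSum (fun k : ℕ => (-x) ^ k / ((k.factorial : ℝ) * Real.Gamma (1 - β * (k + 1))))
      ((∫ r in Ioi (0 : ℝ), wrightKernel θ a β x r).im / π) := by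
  have hθ : 0 < sin θ := sin_pos_of_pos_of_lt_pi (by linarith [pi_pos]) h2
  have hc : cos θ < 0 := cos_neg_of_pi_div_two_lt_of_lt h1 (by linarith [pi_pos])
  have hpos : ∀ r, 0 < ‖rayPoint θ a r‖ := fun r =>
    (mul_pos ha hθ).trans_le (mul_sin_le_rayPoint_norm θ a r)
  have hbound : ∀ r : ℝ, HasSum (fun k : ℕ => |x| ^ k / (k.factorial : ℝ) *
      (exp a * (exp (cos θ * r) * ‖rayPoint θ a r‖ ^ (β * (k + 1) - 1))))
      (exp a * (exp (cos θ * r) * (‖rayPoint θ a r‖ ^ (β - 1) *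
      exp (|x| * ‖rayPoint θ a r‖ ^ β)))) := by
    intro r
    have h := (Real.hasSum_pow_div_factorial (|x| * ‖rayPoint θ a r‖ ^ β)).mul_left
      (exp a * (exp (cos θ * r) * ‖rayPoint θ a r‖ ^ (β - 1)))
    convert! h using 1
    · ext k
      rw [show β * (k + 1) - 1 = (β - 1) + β * k by ring, rpow_add (hpos r), rpow_mul (hpos r).le,
        rpow_natCast, mul_pow]
      ring
    · ring
  have h := hasSum_integral_of_dominated_convergence (μ := volume.restrict (Ioi 0))
    (F := fun (k : ℕ) r => ((((-x) ^ k / (k.factorial : ℝ) : ℝ)) : ℂ) *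
      (Complex.exp (θ * Complex.I) *
        (Complex.exp (rayPoint θ a r) * rayPoint θ a r ^ ((β * (k + 1) - 1 : ℝ) : ℂ))))
    (f := wrightKernel θ a β x)
    (fun (k : ℕ) r => |x| ^ k / (k.factorial : ℝ) *
      (exp a * (exp (cos θ * r) * ‖rayPoint θ a r‖ ^ (β * (k + 1) - 1))))
    (fun k => (((integrableOn_exp_mul_cpow_rayPoint hθ hc ha _).const_mul _).const_mul
      _).aestronglyMeasurable) (fun k => Eventually.of_forall fun r => ?_)
    (Eventually.of_forall fun r => (hbound r).summable) ?_ (Eventually.of_forall fun r => ?_)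
  · have h3 := (Complex.imCLM.hasSum h).div_const π
    refine h3.congr_fun fun k => ?_
    have h4 := rayIntegral_im h1 h2 ha (β * (k + 1) - 1)
    rw [rayIntegral] at h4
    rw [integral_const_mul, Complex.imCLM_apply, Complex.im_ofReal_mul, h4,
      neg_sub]
    field_simp
  · rw [norm_mul, norm_mul, Complex.norm_exp_ofReal_mul_I, one_mul,
      Complex.norm_exp_mul_cpow_rayPoint, Complex.norm_real, norm_div, norm_pow, norm_neg,
      Real.norm_eq_abs, Real.norm_natCast]
  · simp only [fun r => (hbound r).tsum_eq]
    exact integrableOn_norm_rayPoint hθ hc ha hβ _ _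
  · have hne := norm_pos_iff.1 (hpos r)
    have h := (Complex.hasSum_pow_div_factorial (-(x * rayPoint θ a r ^ (β : ℂ)))).mul_left
      (Complex.exp (θ * Complex.I) *
        (Complex.exp (rayPoint θ a r) * rayPoint θ a r ^ ((β - 1 : ℝ) : ℂ)))
    refine h.congr_fun fun k => ?_
    have : rayPoint θ a r ^ ((β * (k + 1) - 1 : ℝ) : ℂ)
        = rayPoint θ a r ^ ((β - 1 : ℝ) : ℂ) * (rayPoint θ a r ^ (β : ℂ)) ^ k := by
      rw [← Complex.cpow_mul_nat, ← Complex.cpow_add _ _ hne]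
      push_cast
      ring_nf
    rw [this, ← neg_mul, mul_pow]
    push_cast
    ring

theorem wrightKernel_norm_le {θ a β x r : ℝ} (h0 : 0 < θ) (hπ : θ < π) (ha : 0 < a) (hr : 0 ≤ r)
    (hβ : 0 < β) (hβθ : β * θ < π / 2) (hx : 0 ≤ x) :
    ‖wrightKernel θ a β x r‖ ≤ exp a * (exp (cos θ * r) * ‖rayPoint θ a r‖ ^ (β - 1)) *
      exp (-((a * sin θ) ^ β * cos (β * θ) * x)) := by
  rw [wrightKernel, norm_mul, norm_mul, Complex.norm_exp_ofReal_mul_I, one_mul,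
    Complex.norm_exp_mul_cpow_rayPoint, Complex.norm_exp, Complex.neg_re, Complex.re_ofReal_mul]
  have := le_rayPoint_cpow_re h0 hπ ha hr hβ hβθ
  rw [mul_comm _ x]
  gcongr

theorem integrable_wrightKernel_mul_pow {θ a β τ : ℝ} (h1 : π / 2 < θ) (h2 : θ < π) (ha : 0 < a)
    (hβ : 0 < β) (hβθ : β * θ < π / 2) (hτ : 0 < τ) (n : ℕ) :
    Integrable (Function.uncurry fun s r : ℝ => wrightKernel θ a β (s * τ) r * (s : ℂ) ^ n)
      ((volume.restrict (Ioi 0)).prod (volume.restrict (Ioi 0))) := by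
  have h0 : 0 < θ := by linarith [pi_pos]
  have hθ : 0 < sin θ := sin_pos_of_pos_of_lt_pi h0 h2
  have hc : cos θ < 0 := cos_neg_of_pi_div_two_lt_of_lt h1 (by linarith [pi_pos])
  have hcβ : 0 < cos (β * θ) := cos_pos_of_mem_Ioo ⟨by nlinarith [pi_pos], hβθ⟩
  set γ := (a * sin θ) ^ β * cos (β * θ) * τ with hγ
  have hγ0 : 0 < γ := by positivity
  have hs := integrableOn_rpow_mul_exp_neg_mul (v := n)
    (by have := n.cast_nonneg (α := ℝ); linarith) hγ0
  have hr := integrableOn_norm_rayPoint hθ hc ha zero_lt_one (β - 1) 0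
  simp only [zero_mul, exp_zero, mul_one] at hr
  refine (Integrable.mul_prod hs hr).mono' ?_ ?_
  · rw [Measure.prod_restrict]
    refine ContinuousOn.aestronglyMeasurable ?_ (measurableSet_Ioi.prod measurableSet_Ioi)
    have hp : ContinuousOn (fun p : ℝ × ℝ => rayPoint θ a p.2) (Ioi 0 ×ˢ Ioi 0) :=
      ((continuous_rayPoint θ a).comp continuous_snd).continuousOn
    have hsl : ∀ p ∈ (Ioi 0 ×ˢ Ioi 0 : Set (ℝ × ℝ)), rayPoint θ a p.2 ∈ Complex.slitPlane :=
      fun p hp => rayPoint_mem_slitPlane hθ (mem_Ioi.1 hp.2).le (add_pos ha hp.2)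
    have hq : ∀ q : ℂ, ContinuousOn (fun p : ℝ × ℝ => rayPoint θ a p.2 ^ q) (Ioi 0 ×ˢ Ioi 0) :=
      fun q => hp.cpow_const hsl
    have hx : ContinuousOn (fun p : ℝ × ℝ => ((p.1 * τ : ℝ) : ℂ)) (Ioi 0 ×ˢ Ioi 0) := by fun_prop
    exact ((continuousOn_const.mul (hp.cexp.mul (hq _))).mul (hx.mul (hq _)).neg.cexp).mul
      (by fun_prop)
  · rw [Measure.prod_restrict]
    refine (ae_restrict_mem (measurableSet_Ioi.prod measurableSet_Ioi)).mono ?_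
    rintro ⟨s, r⟩ ⟨hs, hr⟩
    have hs : 0 < s := hs
    have hr : 0 < r := hr
    simp only [Function.uncurry_apply_pair]
    rw [norm_mul, norm_pow, Complex.norm_real, Real.norm_of_nonneg hs.le, rpow_natCast,
      mul_comm, mul_assoc, mul_comm (exp (-γ * s))]
    gcongr
    refine (wrightKernel_norm_le h0 h2 ha hr.le hβ hβθ (by positivity)).trans_eq ?_
    rw [hγ]
    ring_nf

theorem integral_wrightKernel_mul_pow {θ a β τ : ℝ} (h1 : π / 2 < θ) (h2 : θ < π) (ha : 0 < a)
    (hβ : 0 < β) (hβθ : β * θ < π / 2) (hτ : 0 < τ) (n : ℕ) :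
    (∫ s in Ioi (0 : ℝ), ∫ r in Ioi (0 : ℝ), wrightKernel θ a β (s * τ) r * (s : ℂ) ^ n).im
      = π * (n.factorial / (τ ^ (n + 1) * Real.Gamma (n * β + 1))) := by
  have h0 : 0 < θ := by linarith [pi_pos]
  have hθ : 0 < sin θ := sin_pos_of_pos_of_lt_pi h0 h2
  have hcβ : 0 < cos (β * θ) := cos_pos_of_mem_Ioo ⟨by nlinarith [pi_pos], hβθ⟩
  have hpos : ∀ r, 0 < ‖rayPoint θ a r‖ := fun r =>
    (mul_pos ha hθ).trans_le (mul_sin_le_rayPoint_norm θ a r)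
  rw [integral_integral_swap (integrable_wrightKernel_mul_pow h1 h2 ha hβ hβθ hτ n)]
  have hinner : ∀ r ∈ Ioi (0 : ℝ), ∫ s in Ioi (0 : ℝ), wrightKernel θ a β (s * τ) r * (s : ℂ) ^ n
      = ((n.factorial / τ ^ (n + 1) : ℝ) : ℂ) * (Complex.exp (θ * Complex.I) *
        (Complex.exp (rayPoint θ a r) * rayPoint θ a r ^ ((-(n * β + 1) : ℝ) : ℂ))) := by
    intro r hr
    have hre : 0 < (τ * rayPoint θ a r ^ (β : ℂ)).re := by
      rw [Complex.re_ofReal_mul]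
      exact mul_pos hτ (lt_of_lt_of_le (by positivity)
        (le_rayPoint_cpow_re h0 h2 ha (mem_Ioi.1 hr).le hβ hβθ))
    have hne := norm_pos_iff.1 (hpos r)
    have hpw : rayPoint θ a r ^ ((-(n * β + 1) : ℝ) : ℂ) * (rayPoint θ a r ^ (β : ℂ)) ^ (n + 1)
        = rayPoint θ a r ^ ((β - 1 : ℝ) : ℂ) := by
      rw [← Complex.cpow_mul_nat, ← Complex.cpow_add _ _ hne]
      push_cast
      ring_nf
    have hβne : rayPoint θ a r ^ (β : ℂ) ≠ 0 := by simp [Complex.cpow_eq_zero_iff, hne]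
    have hτne : (τ : ℂ) ≠ 0 := by exact_mod_cast hτ.ne'
    have heq : ∀ s : ℝ, wrightKernel θ a β (s * τ) r * (s : ℂ) ^ n =
        Complex.exp (θ * Complex.I) *
          (Complex.exp (rayPoint θ a r) * rayPoint θ a r ^ ((β - 1 : ℝ) : ℂ)) *
        ((s : ℂ) ^ n * Complex.exp (-(τ * rayPoint θ a r ^ (β : ℂ) * s))) := by
      intro s
      rw [wrightKernel, show ((s * τ : ℝ) : ℂ) * rayPoint θ a r ^ (β : ℂ)
        = τ * rayPoint θ a r ^ (β : ℂ) * s by push_cast; ring]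
      ring
    simp only [heq]
    rw [integral_const_mul, integral_pow_mul_cexp_neg_mul hre, ← hpw, mul_pow]
    push_cast
    field_simp
  rw [setIntegral_congr_fun measurableSet_Ioi hinner, integral_const_mul, Complex.im_ofReal_mul]
  have h3 := rayIntegral_im h1 h2 ha (-(n * β + 1))
  rw [rayIntegral, neg_neg] at h3
  rw [h3]
  field_simp

theorem wrightG_eq_integral {θ a β : ℝ} (h1 : π / 2 < θ) (h2 : θ < π) (ha : 0 < a)
    (hβ1 : β < 1) {t : ℝ} (ht : 0 < t) (s : ℝ) :
    wrightG β s t = t ^ (-β) / π * (∫ r in Ioi (0 : ℝ), wrightKernel θ a β (s * t ^ (-β)) r).im := by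
  have h := (hasSum_wrightSeries h1 h2 ha hβ1 (s * t ^ (-β))).tsum_eq
  rw [wrightG, neg_div, div_eq_mul_inv s, ← rpow_neg ht.le, h]
  ring

theorem integrableOn_integral_wrightKernel_mul_pow {θ a β τ : ℝ} (h1 : π / 2 < θ) (h2 : θ < π)
    (ha : 0 < a) (hβ : 0 < β) (hβθ : β * θ < π / 2) (hτ : 0 < τ) (n : ℕ) :
    IntegrableOn (fun s : ℝ => ∫ r in Ioi (0 : ℝ), wrightKernel θ a β (s * τ) r * (s : ℂ) ^ n)
      (Ioi 0) :=
  (integrable_wrightKernel_mul_pow h1 h2 ha hβ hβθ hτ n).integral_prod_left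

theorem wrightG_mul_pow_eq {θ a β : ℝ} (h1 : π / 2 < θ) (h2 : θ < π) (ha : 0 < a)
    (hβ1 : β < 1) {t : ℝ} (ht : 0 < t) (n : ℕ) (s : ℝ) :
    wrightG β s t * s ^ n = t ^ (-β) / π * Complex.imCLM
      (∫ r in Ioi (0 : ℝ), wrightKernel θ a β (s * t ^ (-β)) r * (s : ℂ) ^ n) := by
  rw [wrightG_eq_integral h1 h2 ha hβ1 ht, integral_mul_const, ← Complex.ofReal_pow,
    Complex.imCLM_apply, Complex.im_mul_ofReal, mul_assoc]

theorem exists_ray_angle {β : ℝ} (hβ0 : 0 < β) (hβ1 : β < 1) :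
    ∃ θ, π / 2 < θ ∧ θ < π ∧ β * θ < π / 2 := by
  obtain ⟨θ, h1, h2⟩ := exists_between (show π / 2 < min π (π / 2 / β) from
    lt_min (by linarith [pi_pos]) (by rw [lt_div_iff₀ hβ0]; nlinarith [pi_pos]))
  have h3 := (lt_div_iff₀ hβ0).1 (h2.trans_le (min_le_right _ _))
  exact ⟨θ, h1, h2.trans_le (min_le_left _ _), by linarith⟩

/-- The moments of the Wright-type density. -/
theorem integral_wrightG_mul_pow {β : ℝ} (hβ0 : 0 < β) (hβ1 : β < 1) {t : ℝ} (ht : 0 < t) (n : ℕ) :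
    ∫ s in Ioi (0 : ℝ), wrightG β s t * s ^ n
      = n.factorial * t ^ ((n : ℝ) * β) / Real.Gamma ((n : ℝ) * β + 1) := by
  obtain ⟨θ, h1, h2, h3⟩ := exists_ray_angle hβ0 hβ1
  have hτ : 0 < t ^ (-β) := by positivity
  simp only [wrightG_mul_pow_eq h1 h2 one_pos hβ1 ht]
  rw [integral_const_mul, ContinuousLinearMap.integral_comp_comm _
    (integrableOn_integral_wrightKernel_mul_pow h1 h2 one_pos hβ0 h3 hτ n), Complex.imCLM_apply,
    integral_wrightKernel_mul_pow h1 h2 one_pos hβ0 h3 hτ]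
  have h4 : t ^ ((n : ℝ) * β) = ((t ^ (-β)) ^ n)⁻¹ := by
    rw [← rpow_natCast, ← rpow_mul ht.le, ← rpow_neg ht.le]
    ring_nf
  rw [h4, pow_succ]
  field_simp

theorem aestronglyMeasurable_wrightG {β : ℝ} (hβ0 : 0 < β) (hβ1 : β < 1) {t : ℝ} (ht : 0 < t) :
    AEStronglyMeasurable (fun s => wrightG β s t) (volume.restrict (Ioi 0)) := by
  obtain ⟨θ, h1, h2, h3⟩ := exists_ray_angle hβ0 hβ1
  have hτ : 0 < t ^ (-β) := by positivity
  have h := ((Complex.imCLM.integrable_comp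
    (integrableOn_integral_wrightKernel_mul_pow h1 h2 one_pos hβ0 h3 hτ 0)).const_mul
      (t ^ (-β) / π)).aestronglyMeasurable
  refine h.congr (Eventually.of_forall fun s => ?_)
  have := wrightG_mul_pow_eq h1 h2 one_pos hβ1 ht 0 s
  rw [pow_zero, mul_one] at this
  exact this.symm

/-- The Wright-type density decays faster than any exponential. -/
theorem exists_abs_wrightG_le {β : ℝ} (hβ0 : 0 < β) (hβ1 : β < 1) {t : ℝ} (ht : 0 < t) {γ : ℝ}
    (hγ : 0 < γ) : ∃ K : ℝ, ∀ s, 0 ≤ s → |wrightG β s t| ≤ K * exp (-γ * s) := by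
  obtain ⟨θ, h1, h2, h3⟩ := exists_ray_angle hβ0 hβ1
  have h0 : 0 < θ := by linarith [pi_pos]
  have hθ : 0 < sin θ := sin_pos_of_pos_of_lt_pi h0 h2
  have hc : cos θ < 0 := cos_neg_of_pi_div_two_lt_of_lt h1 (by linarith [pi_pos])
  have hcβ : 0 < cos (β * θ) := cos_pos_of_mem_Ioo ⟨by nlinarith [pi_pos], h3⟩
  have hτ : 0 < t ^ (-β) := by positivity
  set a := (γ / (cos (β * θ) * t ^ (-β))) ^ β⁻¹ / sin θ with ha'
  have ha : 0 < a := by positivity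
  have haγ : (a * sin θ) ^ β * cos (β * θ) * t ^ (-β) = γ := by
    rw [ha', div_mul_cancel₀ _ hθ.ne', rpow_inv_rpow (by positivity) hβ0.ne']
    field_simp
  have hr := integrableOn_norm_rayPoint hθ hc ha zero_lt_one (β - 1) 0
  simp only [zero_mul, exp_zero, mul_one] at hr
  refine ⟨t ^ (-β) / π * ∫ r in Ioi (0 : ℝ),
    exp a * (exp (cos θ * r) * ‖rayPoint θ a r‖ ^ (β - 1)), fun s hs => ?_⟩
  rw [wrightG_eq_integral h1 h2 ha hβ1 ht, abs_mul, abs_of_pos (by positivity), mul_assoc,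
    ← integral_mul_const]
  gcongr
  refine (Complex.abs_im_le_norm _).trans (norm_integral_le_of_norm_le (hr.mul_const _) ?_)
  refine (ae_restrict_mem measurableSet_Ioi).mono fun r hr => ?_
  refine (wrightKernel_norm_le h0 h2 ha (mem_Ioi.1 hr).le hβ0 h3 (by positivity)).trans_eq ?_
  rw [← haγ]
  ring_nf

/-- If `f(s) = ∑ c_n s^n / n!` everywhere on `[0,∞)` with `|c_n| ≤ C M^n`,
then the Wright-type transform `f_β(t) = ∫_0^∞ g_β(s;t) f(s) ds` has the convergent
series expansion `f_β(t) = ∑ c_n t^{nβ} / Γ(nβ + 1)` for every `t > 0`. -/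
theorem wrightTransform_taylor_expansion (β : ℝ) (hβ0 : 0 < β) (hβ1 : β < 1)
    (f : ℝ → ℝ) (c : ℕ → ℝ) (C M : ℝ) (hC : 0 < C) (hM : 0 < M)
    (hf : ∀ s : ℝ, 0 ≤ s → HasSum (fun n : ℕ => c n * s ^ n / (Nat.factorial n : ℝ)) (f s))
    (hc : ∀ n : ℕ, |c n| ≤ C * M ^ n) (t : ℝ) (ht : 0 < t) :
    HasSum (fun n : ℕ => c n * t ^ ((n : ℝ) * β) / Real.Gamma ((n : ℝ) * β + 1))
      (∫ s in Set.Ioi (0:ℝ), wrightG β s t * f s) := by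
  obtain ⟨K, hK⟩ := exists_abs_wrightG_le hβ0 hβ1 ht (γ := M + 1) (by linarith)
  have hbound : ∀ s : ℝ, HasSum
      (fun n : ℕ => K * exp (-(M + 1) * s) * (C * ((M * s) ^ n / (n.factorial : ℝ))))
      (K * C * exp (-1 * s)) := by
    intro s
    convert! ((Real.hasSum_pow_div_factorial (M * s)).mul_left C).mul_left
      (K * exp (-(M + 1) * s)) using 1
    rw [show -1 * s = -(M + 1) * s + M * s by ring, Real.exp_add]
    ring
  have h := hasSum_integral_of_dominated_convergence (μ := volume.restrict (Ioi 0))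
    (F := fun (n : ℕ) s => wrightG β s t * (c n * s ^ n / (n.factorial : ℝ)))
    (f := fun s => wrightG β s t * f s)
    (fun n s => K * exp (-(M + 1) * s) * (C * ((M * s) ^ n / (n.factorial : ℝ))))
    (fun n => (aestronglyMeasurable_wrightG hβ0 hβ1 ht).mul
      (Continuous.aestronglyMeasurable (by fun_prop)))
    (fun n => (ae_restrict_mem measurableSet_Ioi).mono fun s hs => ?_)
    (Eventually.of_forall fun s => (hbound s).summable) ?_
    ((ae_restrict_mem measurableSet_Ioi).mono fun s hs => (hf s (mem_Ioi.1 hs).le).mul_left _)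
  · refine h.congr_fun fun n => ?_
    have : ∀ s : ℝ, wrightG β s t * (c n * s ^ n / (n.factorial : ℝ))
        = c n / (n.factorial : ℝ) * (wrightG β s t * s ^ n) := fun s => by ring
    simp only [this]
    rw [integral_const_mul, integral_wrightG_mul_pow hβ0 hβ1 ht]
    field_simp
  · have hs : 0 < s := hs
    have h1 := hK s hs.le
    rw [norm_mul, Real.norm_eq_abs, Real.norm_eq_abs, abs_div, abs_mul, abs_pow, abs_of_pos hs,
      Nat.abs_cast, mul_pow, mul_div_assoc, mul_div_assoc, ← mul_assoc C]
    refine mul_le_mul h1 ?_ (by positivity) ((abs_nonneg _).trans h1)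
    gcongr
    exact hc n
  · simp only [fun s => (hbound s).tsum_eq]
    have := integrableOn_rpow_mul_exp_neg_mul (v := 0) (by norm_num) one_pos
    simp only [rpow_zero, one_mul] at this
    exact this.const_mul _
end

section
/- For every 0 < β < 1 and every t > 0, the Wright-type transform of the sine function satisfies ∫_0^∞ g_β(s;t) sin(s) ds = t^β · E_{2β,β+1}(−t^{2β}) = ∑_{n=0}^∞ (−1)^n t^{(2n+1)β} / Γ((2n+1)β + 1). -/
open MeasureTheory Real Set Filter

/-- The upper half of a Hankel contour in logarithmic coordinates: it runs up the vertical
segment from `L` to `L + iθ`, then along the horizontal ray towards `+∞ + iθ`. -/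
noncomputable def logHankel (θ L s : ℝ) : ℂ :=
  ((max s L : ℝ) : ℂ) + ((θ + min (s - L) 0 : ℝ) : ℂ) * Complex.I

/-- The velocity of `logHankel θ L`. -/
noncomputable def logHankelDeriv (L s : ℝ) : ℂ := if s < L then Complex.I else 1

/-- The integral of `φ` along the contour `logHankel θ L`. -/
noncomputable def logHankelIntegral (θ L : ℝ) (φ : ℂ → ℂ) : ℂ :=
  ∫ s in Ioi (L - θ), φ (logHankel θ L s) * logHankelDeriv L s

@[simp] lemma logHankel_re (θ L s : ℝ) : (logHankel θ L s).re = max s L := by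
  simp [logHankel]

@[simp] lemma logHankel_im (θ L s : ℝ) : (logHankel θ L s).im = θ + min (s - L) 0 := by
  simp [logHankel]

lemma continuous_logHankel (θ L : ℝ) : Continuous (logHankel θ L) := by
  unfold logHankel
  fun_prop

lemma measurable_logHankelDeriv (L : ℝ) : Measurable (logHankelDeriv L) :=
  Measurable.ite measurableSet_Iio measurable_const measurable_const

@[simp] lemma norm_logHankelDeriv (L s : ℝ) : ‖logHankelDeriv L s‖ = 1 := by
  unfold logHankelDeriv
  split_ifs <;> simp

lemma logHankel_of_le {θ L s : ℝ} (h : L ≤ s) :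
    logHankel θ L s = (s : ℂ) + (θ : ℂ) * Complex.I := by
  simp [logHankel, max_eq_left h, min_eq_right (sub_nonneg.2 h)]

lemma eventually_mul_add_mul_exp_le {β δ : ℝ} (hβ1 : β < 1) (hδ : 0 < δ) (a C : ℝ) :
    ∀ᶠ v in atTop, a * v + C * rexp (β * v) ≤ δ * rexp v := by
  have h1 : (fun v : ℝ => a * v) =o[atTop] rexp := by
    simpa using (Real.isLittleO_pow_exp_atTop (n := 1)).const_mul_left a
  have h2 : (fun v : ℝ => C * rexp (β * v)) =o[atTop] rexp := by
    refine Asymptotics.IsLittleO.const_mul_left ?_ C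
    refine Real.isLittleO_exp_comp_exp_comp.2 ?_
    have : Tendsto (fun v : ℝ => (1 - β) * v) atTop atTop :=
      tendsto_id.const_mul_atTop (by linarith)
    refine this.congr fun v => by ring
  filter_upwards [(h1.add h2).bound hδ] with v hv
  simpa using (le_abs_self _).trans hv

lemma integrable_logHankel_weight {β θ : ℝ} (hβ1 : β < 1) (hθ0 : π / 2 < θ) (hθ1 : θ ≤ π)
    (L a C : ℝ) :
    Integrable (fun s => rexp ((Complex.exp (logHankel θ L s)).re + a * (logHankel θ L s).re
      + C * rexp (β * (logHankel θ L s).re))) (volume.restrict (Ioi (L - θ))) := by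
  refine integrable_of_isBigO_exp_neg one_pos ?_ ?_
  · have := continuous_logHankel θ L
    fun_prop
  · refine Asymptotics.IsBigO.of_bound 1 ?_
    have hcos : 0 < - Real.cos θ := by
      have := Real.cos_neg_of_pi_div_two_lt_of_lt hθ0 (by linarith [Real.pi_pos])
      linarith
    filter_upwards [eventually_mul_add_mul_exp_le hβ1 hcos (a + 1) C, eventually_ge_atTop L]
      with s hs hL
    have him : min (s - L) 0 = 0 := min_eq_right (by linarith)
    simp only [Complex.exp_re, logHankel_re, logHankel_im, max_eq_left hL, him, Real.norm_eq_abs,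
      Real.abs_exp, one_mul, Real.exp_le_exp, add_zero]
    linarith

/-- The integrand in the Hankel representation of the reciprocal Gamma function. -/
noncomputable def hankelFun (a : ℝ) (w : ℂ) : ℂ := Complex.exp (Complex.exp w + a * w)

lemma differentiable_hankelFun (a : ℝ) : Differentiable ℂ (hankelFun a) := by
  unfold hankelFun
  fun_prop

lemma norm_hankelFun (a : ℝ) (w : ℂ) :
    ‖hankelFun a w‖ = rexp ((Complex.exp w).re + a * w.re) := by
  simp [hankelFun, Complex.norm_exp]

lemma hankelFun_add (a b : ℝ) (w : ℂ) :
    hankelFun (a + b) w = hankelFun a w * Complex.exp (b * w) := by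
  rw [hankelFun, hankelFun, ← Complex.exp_add]
  congr 1
  push_cast
  ring

lemma continuous_hankelFun_logHankel (θ L a : ℝ) :
    Continuous fun s => hankelFun a (logHankel θ L s) :=
  (differentiable_hankelFun a).continuous.comp (continuous_logHankel θ L)

lemma integrable_hankelFun_logHankel {θ : ℝ} (hθ0 : π / 2 < θ) (hθ1 : θ ≤ π) (L a : ℝ) :
    Integrable (fun s => hankelFun a (logHankel θ L s) * logHankelDeriv L s)
      (volume.restrict (Ioi (L - θ))) := by
  refine (integrable_logHankel_weight (β := 0) one_pos hθ0 hθ1 L a 0).mono' ?_ ?_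
  · exact (continuous_hankelFun_logHankel θ L a).aestronglyMeasurable.mul
      (measurable_logHankelDeriv L).aestronglyMeasurable
  · refine ae_of_all _ fun s => ?_
    simp [norm_hankelFun]

lemma logHankelIntegral_eq_add {θ L : ℝ} (hθ : 0 ≤ θ) (φ : ℂ → ℂ)
    (h : Integrable (fun s => φ (logHankel θ L s) * logHankelDeriv L s)
      (volume.restrict (Ioi (L - θ)))) :
    logHankelIntegral θ L φ = Complex.I * (∫ y in (0:ℝ)..θ, φ (L + y * Complex.I))
      + ∫ v in Ioi L, φ (v + θ * Complex.I) := by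
  have hle : L - θ ≤ L := by linarith
  have h1 : logHankelIntegral θ L φ
      = (∫ s in (L - θ)..L, φ (logHankel θ L s) * logHankelDeriv L s)
        + ∫ s in Ioi L, φ (logHankel θ L s) * logHankelDeriv L s := by
    rw [logHankelIntegral, intervalIntegral.integral_of_le hle, ← Ioc_union_Ioi_eq_Ioi hle]
    rw [setIntegral_union Ioc_disjoint_Ioi_same measurableSet_Ioi]
    · exact h.mono_measure (Measure.restrict_mono Ioc_subset_Ioi_self le_rfl)
    · exact h.mono_measure (Measure.restrict_mono (Ioi_subset_Ioi hle) le_rfl)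
  have h2 : (∫ s in (L - θ)..L, φ (logHankel θ L s) * logHankelDeriv L s)
      = Complex.I * (∫ y in (0:ℝ)..θ, φ (L + y * Complex.I)) := by
    have e := intervalIntegral.integral_comp_add_right (a := 0) (b := θ)
      (fun s => φ (logHankel θ L s) * logHankelDeriv L s) (L - θ)
    rw [zero_add, show θ + (L - θ) = L by ring] at e
    rw [← e, ← intervalIntegral.integral_const_mul]
    refine intervalIntegral.integral_congr_Ioo_of_le hθ fun y hy => ?_
    have hlt : y + (L - θ) < L := by linarith [hy.2]
    have hmin : min (y + (L - θ) - L) 0 = y - θ := by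
      rw [min_eq_left (by linarith [hy.2])]
      ring
    simp only [logHankel, logHankelDeriv, if_pos hlt, max_eq_right hlt.le, hmin, add_sub_cancel]
    ring
  rw [h1, h2]
  congr 1
  refine setIntegral_congr_fun measurableSet_Ioi fun s hs => ?_
  have hs : L < s := hs
  simp only [logHankel_of_le hs.le, logHankelDeriv, not_lt.2 hs.le, if_false, mul_one]

lemma norm_hankelFun_add_mul_I (a x y : ℝ) :
    ‖hankelFun a (x + y * Complex.I)‖ = rexp (rexp x * Real.cos y + a * x) := by
  simp [norm_hankelFun, Complex.exp_re]

lemma hankelFun_add_pi_mul_I (a v : ℝ) :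
    hankelFun a (v + π * Complex.I)
      = ((rexp (-rexp v + a * v) : ℝ) : ℂ) * Complex.exp ((π * a : ℝ) * Complex.I) := by
  rw [hankelFun, Complex.exp_add (v : ℂ), Complex.exp_pi_mul_I, Complex.ofReal_exp,
    ← Complex.exp_add]
  congr 1
  push_cast
  ring

lemma hankelFun_ofReal_im (a v : ℝ) : (hankelFun a v).im = 0 := by
  have : hankelFun a v = ((rexp (rexp v + a * v) : ℝ) : ℂ) := by
    simp [hankelFun]
  rw [this, Complex.ofReal_im]

lemma integrableOn_hankelFun_ray {θ : ℝ} (hθ0 : π / 2 < θ) (hθ1 : θ ≤ π) (L a : ℝ) :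
    IntegrableOn (fun v : ℝ => hankelFun a (v + θ * Complex.I)) (Ioi L) := by
  have h := (integrable_hankelFun_logHankel hθ0 hθ1 L a).mono_measure
    (Measure.restrict_mono (Ioi_subset_Ioi (a := L) (b := L - θ)
      (by linarith [Real.pi_pos])) le_rfl)
  refine (integrableOn_congr_fun (fun s hs => ?_) measurableSet_Ioi).1 h
  have hs : L < s := hs
  simp only [hankelFun, logHankel_of_le hs.le, logHankelDeriv, not_lt.2 hs.le, if_false, mul_one]

lemma integrable_exp_neg_exp_add {a : ℝ} (ha : 0 < a) :
    Integrable (fun v : ℝ => rexp (-rexp v + a * v)) ∧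
      ∫ v : ℝ, rexp (-rexp v + a * v) = Real.Gamma a := by
  have himg : Real.exp '' univ = Ioi 0 := by rw [image_univ, Real.range_exp]
  have hd : ∀ x ∈ (univ : Set ℝ), HasDerivWithinAt Real.exp (Real.exp x) univ x :=
    fun x _ => (Real.hasDerivAt_exp x).hasDerivWithinAt
  have hinj : InjOn Real.exp univ := Real.exp_injective.injOn
  have hpt : ∀ v : ℝ, |rexp v| • (rexp (-rexp v) * rexp v ^ (a - 1)) = rexp (-rexp v + a * v) := by
    intro v
    rw [abs_of_pos (Real.exp_pos v), ← Real.exp_mul, smul_eq_mul, ← Real.exp_add, ← Real.exp_add]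
    congr 1
    ring
  constructor
  · have := (integrableOn_image_iff_integrableOn_abs_deriv_smul MeasurableSet.univ hd hinj
      (fun x => rexp (-x) * x ^ (a - 1))).1 (himg ▸ Real.GammaIntegral_convergent ha)
    simpa only [hpt, integrableOn_univ] using this
  · rw [Real.Gamma_eq_integral ha, ← himg,
      integral_image_eq_integral_abs_deriv_smul MeasurableSet.univ hd hinj]
    simp only [hpt, Measure.restrict_univ]

lemma hankelFun_rect (a x₀ x₁ y₀ y₁ : ℝ) :
    (∫ x in x₀..x₁, hankelFun a (x + y₀ * Complex.I))
      - (∫ x in x₀..x₁, hankelFun a (x + y₁ * Complex.I))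
      + Complex.I * (∫ y in y₀..y₁, hankelFun a (x₁ + y * Complex.I))
      - Complex.I * (∫ y in y₀..y₁, hankelFun a (x₀ + y * Complex.I)) = 0 := by
  simpa using Complex.integral_boundary_rect_eq_zero_of_differentiableOn (hankelFun a)
    (x₀ + y₀ * Complex.I) (x₁ + y₁ * Complex.I) (differentiable_hankelFun a).differentiableOn

lemma tendsto_hankelFun_vertical_atBot {a : ℝ} (ha : 0 < a) (y₀ y₁ : ℝ) :
    Tendsto (fun x : ℝ => ∫ y in y₀..y₁, hankelFun a (x + y * Complex.I)) atBot (nhds 0) := by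
  have h : ∀ x : ℝ, ‖∫ y in y₀..y₁, hankelFun a (x + y * Complex.I)‖
      ≤ rexp (rexp x + a * x) * |y₁ - y₀| := by
    intro x
    refine intervalIntegral.norm_integral_le_of_norm_le_const fun y _ => ?_
    rw [norm_hankelFun_add_mul_I]
    gcongr
    exact mul_le_of_le_one_right (Real.exp_pos x).le (Real.cos_le_one y)
  refine squeeze_zero_norm h ?_
  have h1 : Tendsto (fun x : ℝ => rexp x + a * x) atBot atBot :=
    Real.tendsto_exp_atBot.add_atBot (tendsto_id.const_mul_atBot ha)
  simpa using (Real.tendsto_exp_atBot.comp h1).mul_const |y₁ - y₀|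

lemma tendsto_exp_mul_add_mul_atTop {δ : ℝ} (hδ : δ < 0) (a : ℝ) :
    Tendsto (fun x : ℝ => rexp (rexp x * δ + a * x)) atTop (nhds 0) := by
  refine Real.tendsto_exp_atBot.comp ?_
  refine tendsto_atBot_mono' atTop ?_ tendsto_neg_atTop_atBot
  filter_upwards [eventually_mul_add_mul_exp_le (β := 0) one_pos (neg_pos.2 hδ) (a + 1) 0] with x hx
  linarith

lemma tendsto_hankelFun_vertical_atTop {θ : ℝ} (hθ0 : π / 2 < θ) (hθ1 : θ ≤ π) (a : ℝ) :
    Tendsto (fun x : ℝ => ∫ y in θ..π, hankelFun a (x + y * Complex.I)) atTop (nhds 0) := by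
  have h : ∀ x : ℝ, ‖∫ y in θ..π, hankelFun a (x + y * Complex.I)‖
      ≤ rexp (rexp x * Real.cos θ + a * x) * |π - θ| := by
    intro x
    refine intervalIntegral.norm_integral_le_of_norm_le_const fun y hy => ?_
    rw [uIoc_of_le hθ1] at hy
    rw [norm_hankelFun_add_mul_I]
    gcongr
    exact Real.cos_le_cos_of_nonneg_of_le_pi (by linarith [Real.pi_pos]) hy.2 hy.1.le
  refine squeeze_zero_norm h ?_
  have hcos := Real.cos_neg_of_pi_div_two_lt_of_lt hθ0 (by linarith [Real.pi_pos])
  simpa using (tendsto_exp_mul_add_mul_atTop hcos a).mul_const |π - θ|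

/-- The opening angle of the Hankel contour may be widened to `π`. -/
lemma hankelFun_contour_eq_pi {θ : ℝ} (hθ0 : π / 2 < θ) (hθ1 : θ ≤ π) (L a : ℝ) :
    Complex.I * (∫ y in (0:ℝ)..θ, hankelFun a (L + y * Complex.I))
      + (∫ v in Ioi L, hankelFun a (v + θ * Complex.I))
    = Complex.I * (∫ y in (0:ℝ)..π, hankelFun a (L + y * Complex.I))
      + ∫ v in Ioi L, hankelFun a (v + π * Complex.I) := by
  have t1 := intervalIntegral_tendsto_integral_Ioi L
    (integrableOn_hankelFun_ray hθ0 hθ1 L a) tendsto_id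
  have t2 := intervalIntegral_tendsto_integral_Ioi L
    (integrableOn_hankelFun_ray (hθ0.trans_le hθ1) le_rfl L a) tendsto_id
  have t3 := (tendsto_hankelFun_vertical_atTop hθ0 hθ1 a).const_mul Complex.I
  have t := ((t1.sub t2).add t3).sub_const
    (Complex.I * (∫ y in θ..π, hankelFun a (L + y * Complex.I)))
  have hz := tendsto_nhds_unique t
    (tendsto_const_nhds.congr fun R => (hankelFun_rect a L R θ π).symm)
  have hc : Continuous fun y : ℝ => hankelFun a (L + y * Complex.I) :=
    (differentiable_hankelFun a).continuous.comp (by fun_prop)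
  rw [← intervalIntegral.integral_add_adjacent_intervals (hc.intervalIntegrable 0 θ)
    (hc.intervalIntegrable θ π)]
  linear_combination hz

lemma hankelFun_contour_im_of_pos {a : ℝ} (ha : 0 < a) (L : ℝ) :
    (Complex.I * (∫ y in (0:ℝ)..π, hankelFun a (L + y * Complex.I))
      + ∫ v in Ioi L, hankelFun a (v + π * Complex.I)).im = Real.Gamma a * Real.sin (π * a) := by
  obtain ⟨hint, hval⟩ := integrable_exp_neg_exp_add ha
  have hI : Integrable fun v : ℝ => hankelFun a (v + π * Complex.I) := by
    simp only [hankelFun_add_pi_mul_I]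
    exact hint.ofReal.mul_const _
  have t1 := intervalIntegral_tendsto_integral_Iic L hI.integrableOn tendsto_id
  have t2 := (tendsto_hankelFun_vertical_atBot ha 0 π).const_mul Complex.I
  have t := (Complex.continuous_im.tendsto _).comp (((t1.neg).add_const
    (Complex.I * (∫ y in (0:ℝ)..π, hankelFun a (L + y * Complex.I)))).sub t2)
  have hz := tendsto_nhds_unique t (tendsto_const_nhds.congr (f₁ := fun _ => (0 : ℝ)) fun R => by
    have h0 : (∫ x in R..L, hankelFun a (x + (0 : ℝ) * Complex.I)).im = 0 := by
      have : ∀ x : ℝ, hankelFun a (x + (0 : ℝ) * Complex.I)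
          = ((rexp (rexp x + a * x) : ℝ) : ℂ) := by
        intro x
        simp [hankelFun]
      simp only [this, intervalIntegral.integral_ofReal, Complex.ofReal_im]
    have := congrArg Complex.im (hankelFun_rect a R L 0 π)
    simp only [Complex.sub_im, Complex.add_im, h0, Complex.zero_im] at this
    simp only [Function.comp, Complex.sub_im, Complex.add_im, Complex.neg_im, id]
    linarith)
  have hsum : (∫ v in Iic L, hankelFun a (v + π * Complex.I))
      + ∫ v in Ioi L, hankelFun a (v + π * Complex.I)
      = (Real.Gamma a : ℂ) * Complex.exp ((π * a : ℝ) * Complex.I) := by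
    rw [intervalIntegral.integral_Iic_add_Ioi hI.integrableOn hI.integrableOn]
    simp only [hankelFun_add_pi_mul_I]
    rw [integral_mul_const, integral_complex_ofReal, hval]
  have him := congrArg Complex.im hsum
  rw [Complex.im_ofReal_mul, Complex.exp_ofReal_mul_I_im] at him
  simp only [Complex.sub_im, Complex.add_im, Complex.neg_im, mul_zero, Complex.zero_im] at hz him ⊢
  linarith

lemma logHankelIntegral_hankelFun_im_of_pos {θ a : ℝ} (hθ0 : π / 2 < θ) (hθ1 : θ ≤ π)
    (ha : 0 < a) (L : ℝ) :
    (logHankelIntegral θ L (hankelFun a)).im = π / Real.Gamma (1 - a) := by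
  rw [logHankelIntegral_eq_add (by linarith [Real.pi_pos]) _
    (integrable_hankelFun_logHankel hθ0 hθ1 L a), hankelFun_contour_eq_pi hθ0 hθ1,
    hankelFun_contour_im_of_pos ha]
  have h := Real.Gamma_mul_Gamma_one_sub a
  have hG := (Real.Gamma_pos_of_pos ha).ne'
  by_cases h1 : Real.Gamma (1 - a) = 0
  · rw [h1, mul_zero, eq_comm, div_eq_zero_iff] at h
    simp [h1, h.resolve_left Real.pi_ne_zero]
  · have hs : Real.sin (π * a) ≠ 0 := by
      intro hs
      rw [hs, div_zero] at h
      exact (mul_ne_zero hG h1) h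
    rw [eq_div_iff hs] at h
    rw [eq_div_iff h1]
    linarith

lemma hasDerivAt_hankelFun (a : ℝ) (w : ℂ) :
    HasDerivAt (hankelFun a) (hankelFun (a + 1) w + a * hankelFun a w) w := by
  have h : HasDerivAt (fun w : ℂ => Complex.exp w + a * w) (Complex.exp w + a * 1) w :=
    (Complex.hasDerivAt_exp w).add ((hasDerivAt_id w).const_mul (a : ℂ))
  refine h.cexp.congr_deriv ?_
  have : hankelFun (a + 1) w = hankelFun a w * Complex.exp w := by
    simpa using hankelFun_add a 1 w
  rw [this, hankelFun]
  ring

lemma logHankelIntegral_hankelFun_add_one {θ : ℝ} (hθ0 : π / 2 < θ) (hθ1 : θ ≤ π) (L a : ℝ) :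
    logHankelIntegral θ L (hankelFun (a + 1)) + a * logHankelIntegral θ L (hankelFun a)
      = -hankelFun a L := by
  have hθ : 0 ≤ θ := by linarith [Real.pi_pos]
  have hc : ∀ b : ℝ, Continuous fun y : ℝ => hankelFun b (L + y * Complex.I) := fun b =>
    (differentiable_hankelFun b).continuous.comp (by fun_prop)
  have hray : (∫ v in Ioi L, hankelFun (a + 1) (v + θ * Complex.I))
      + a * (∫ v in Ioi L, hankelFun a (v + θ * Complex.I))
      = -hankelFun a (L + θ * Complex.I) := by
    have hd : ∀ v : ℝ, HasDerivAt (fun v : ℝ => hankelFun a (v + θ * Complex.I))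
        (hankelFun (a + 1) (v + θ * Complex.I) + a * hankelFun a (v + θ * Complex.I)) v := by
      intro v
      exact (HasDerivAt.comp_add_const (v : ℂ) (θ * Complex.I)
        (hasDerivAt_hankelFun a (v + θ * Complex.I))).comp_ofReal
    have hi1 := integrableOn_hankelFun_ray hθ0 hθ1 L (a + 1)
    have hi2 := (integrableOn_hankelFun_ray hθ0 hθ1 L a).const_mul (a : ℂ)
    have ht : Tendsto (fun v : ℝ => hankelFun a (v + θ * Complex.I)) atTop (nhds 0) := by
      rw [tendsto_zero_iff_norm_tendsto_zero]
      simp only [norm_hankelFun_add_mul_I]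
      exact tendsto_exp_mul_add_mul_atTop
        (Real.cos_neg_of_pi_div_two_lt_of_lt hθ0 (by linarith [Real.pi_pos])) a
    have := integral_Ioi_of_hasDerivAt_of_tendsto (a := L) (hd L).continuousAt.continuousWithinAt
      (fun v _ => hd v) (hi1.add hi2) ht
    rw [integral_add hi1 hi2, integral_const_mul] at this
    rw [this, zero_sub]
  have hvert : Complex.I * (∫ y in (0:ℝ)..θ, hankelFun (a + 1) (L + y * Complex.I))
      + a * (Complex.I * ∫ y in (0:ℝ)..θ, hankelFun a (L + y * Complex.I))
      = hankelFun a (L + θ * Complex.I) - hankelFun a L := by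
    have hd : ∀ y : ℝ, HasDerivAt (fun y : ℝ => hankelFun a (L + y * Complex.I))
        ((hankelFun (a + 1) (L + y * Complex.I) + a * hankelFun a (L + y * Complex.I))
          * Complex.I) y := by
      intro y
      have h := (hasDerivAt_hankelFun a (L + y * Complex.I)).comp (y : ℂ)
        (((hasDerivAt_id (y : ℂ)).mul_const Complex.I).const_add (L : ℂ))
      rw [one_mul] at h
      exact h.comp_ofReal
    have := intervalIntegral.integral_eq_sub_of_hasDerivAt (a := 0) (b := θ) (fun y _ => hd y)
      ((((hc (a + 1)).add ((hc a).const_mul (a : ℂ))).mul continuous_const).intervalIntegrable _ _)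
    rw [intervalIntegral.integral_mul_const, intervalIntegral.integral_add
      ((hc (a + 1)).intervalIntegrable _ _) (((hc a).const_mul (a : ℂ)).intervalIntegrable _ _),
      intervalIntegral.integral_const_mul] at this
    simp only [Complex.ofReal_zero, zero_mul, add_zero] at this
    linear_combination this
  rw [logHankelIntegral_eq_add hθ _ (integrable_hankelFun_logHankel hθ0 hθ1 L a),
    logHankelIntegral_eq_add hθ _ (integrable_hankelFun_logHankel hθ0 hθ1 L (a + 1))]
  linear_combination hray + hvert

lemma logHankelIntegral_hankelFun_zero_im {θ L : ℝ} (hθ0 : π / 2 < θ) (hθ1 : θ ≤ π)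
    (hL : 0 ≤ L) : (logHankelIntegral θ L (hankelFun 0)).im = π := by
  have hcont : Tendsto (fun a => logHankelIntegral θ L (hankelFun a)) (nhdsWithin 0 (Ioi 0))
      (nhds (logHankelIntegral θ L (hankelFun 0))) := by
    refine tendsto_integral_filter_of_dominated_convergence _
      (Eventually.of_forall fun a => (integrable_hankelFun_logHankel hθ0 hθ1 L a).1) ?_
      (integrable_hankelFun_logHankel hθ0 hθ1 L 1).norm ?_
    · filter_upwards [Ioo_mem_nhdsGT (zero_lt_one' ℝ)] with a ha
      refine ae_of_all _ fun s => ?_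
      have h0 : 0 ≤ max s L := le_max_of_le_right hL
      simp only [norm_mul, norm_logHankelDeriv, mul_one, norm_hankelFun, logHankel_re]
      gcongr
      exact ha.2.le
    · refine ae_of_all _ fun s => ?_
      have : Continuous fun a : ℝ =>
          hankelFun a (logHankel θ L s) * logHankelDeriv L s := by
        unfold hankelFun
        fun_prop
      exact (this.tendsto 0).mono_left nhdsWithin_le_nhds
  have h1 := (Complex.continuous_im.tendsto _).comp hcont
  have h2 : Tendsto (fun a : ℝ => π / Real.Gamma (1 - a)) (nhdsWithin 0 (Ioi 0)) (nhds π) := by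
    have hG : ContinuousAt Real.Gamma (1 - 0) := by
      refine (Real.differentiableAt_Gamma fun m => ?_).continuousAt
      have : (0 : ℝ) ≤ m := m.cast_nonneg
      linarith
    have hcomp : ContinuousAt (fun a : ℝ => π / Real.Gamma (1 - a)) 0 :=
      continuousAt_const.div (ContinuousAt.comp (g := Real.Gamma) hG (by fun_prop)) (by simp)
    have := hcomp.tendsto.mono_left (nhdsWithin_le_nhds (s := Ioi 0))
    simpa using this
  refine tendsto_nhds_unique h1 (h2.congr' ?_)
  filter_upwards [self_mem_nhdsWithin] with a ha
  exact (logHankelIntegral_hankelFun_im_of_pos hθ0 hθ1 ha L).symm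

/-- Hankel's formula for the reciprocal of the Gamma function. -/
lemma logHankelIntegral_hankelFun_im {θ L : ℝ} (hθ0 : π / 2 < θ) (hθ1 : θ ≤ π) (hL : 0 ≤ L)
    (a : ℝ) : (logHankelIntegral θ L (hankelFun a)).im = π / Real.Gamma (1 - a) := by
  suffices h : ∀ n : ℕ, ∀ a : ℝ, -(n : ℝ) < a →
      (logHankelIntegral θ L (hankelFun a)).im = π / Real.Gamma (1 - a) by
    obtain ⟨n, hn⟩ := exists_nat_gt (-a)
    exact h n a (by linarith)
  intro n
  induction n with
  | zero =>
    intro a ha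
    exact logHankelIntegral_hankelFun_im_of_pos hθ0 hθ1 (by simpa using ha) L
  | succ n ih =>
    intro a ha
    push_cast at ha
    rcases lt_trichotomy a 0 with h | h | h
    · have hrec := congrArg Complex.im (logHankelIntegral_hankelFun_add_one hθ0 hθ1 L a)
      rw [Complex.add_im, Complex.im_ofReal_mul, Complex.neg_im, hankelFun_ofReal_im,
        ih (a + 1) (by linarith), neg_zero] at hrec
      have hG : Real.Gamma (1 - a) = -a * Real.Gamma (1 - (a + 1)) := by
        rw [show 1 - a = -a + 1 by ring, Real.Gamma_add_one (by linarith)]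
        congr 2
        ring
      have hG0 : Real.Gamma (1 - (a + 1)) ≠ 0 := (Real.Gamma_pos_of_pos (by linarith)).ne'
      rw [hG, eq_div_iff (mul_ne_zero (by linarith) hG0)]
      linear_combination -Real.Gamma (1 - (a + 1)) * hrec + div_mul_cancel₀ π hG0
    · subst h
      simpa using logHankelIntegral_hankelFun_zero_im hθ0 hθ1 hL
    · exact logHankelIntegral_hankelFun_im_of_pos hθ0 hθ1 h L

lemma norm_exp_ofReal_mul (β : ℝ) (w : ℂ) : ‖Complex.exp (β * w)‖ = rexp (β * w.re) := by
  simp [Complex.norm_exp]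

lemma hasSum_logHankelIntegral_wright {β θ : ℝ} (hβ1 : β < 1) (hθ0 : π / 2 < θ) (hθ1 : θ ≤ π)
    (L x : ℝ) :
    HasSum (fun k : ℕ => (((-x) ^ k / (Nat.factorial k : ℝ) : ℝ) : ℂ)
        * logHankelIntegral θ L (hankelFun (β * (k + 1))))
      (logHankelIntegral θ L fun w => hankelFun β w * Complex.exp (-x * Complex.exp (β * w))) := by
  have hF : ∀ (k : ℕ) (w : ℂ), (((-x) ^ k / (Nat.factorial k : ℝ) : ℝ) : ℂ)
      * hankelFun (β * (k + 1)) w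
      = hankelFun β w * ((-x * Complex.exp (β * w)) ^ k / (Nat.factorial k : ℂ)) := by
    intro k w
    rw [show β * ((k : ℝ) + 1) = β + k * β by ring, hankelFun_add, mul_pow, ← Complex.exp_nat_mul]
    push_cast
    rw [show (k : ℂ) * β * w = k * (β * w) by ring]
    ring
  have hexp : ∀ y : ℝ, HasSum (fun k : ℕ => y ^ k / (Nat.factorial k : ℝ)) (rexp y) := by
    intro y
    rw [Real.exp_eq_exp_ℝ]
    exact NormedSpace.expSeries_div_hasSum_exp y
  have hexpC : ∀ z : ℂ, HasSum (fun k : ℕ => z ^ k / (Nat.factorial k : ℂ)) (Complex.exp z) := by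
    intro z
    rw [Complex.exp_eq_exp_ℂ]
    exact NormedSpace.expSeries_div_hasSum_exp z
  simp only [logHankelIntegral, ← integral_const_mul, ← mul_assoc, hF]
  have hb : ∀ s : ℝ, HasSum (fun k : ℕ => ‖hankelFun β (logHankel θ L s)‖
      * ((|x| * rexp (β * (logHankel θ L s).re)) ^ k / (Nat.factorial k : ℝ)))
      (‖hankelFun β (logHankel θ L s)‖ * rexp (|x| * rexp (β * (logHankel θ L s).re))) :=
    fun s => (hexp _).mul_left _
  refine hasSum_integral_of_dominated_convergence (fun k s => ‖hankelFun β (logHankel θ L s)‖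
    * ((|x| * rexp (β * (logHankel θ L s).re)) ^ k / (Nat.factorial k : ℝ))) ?_ ?_ ?_ ?_ ?_
  · intro k
    have h1 := continuous_hankelFun_logHankel θ L β
    have h2 := continuous_logHankel θ L
    exact (by fun_prop : Continuous _).aestronglyMeasurable.mul
      (measurable_logHankelDeriv L).aestronglyMeasurable
  · refine fun k => ae_of_all _ fun s => le_of_eq ?_
    simp only [norm_mul, norm_div, norm_pow, norm_neg, norm_logHankelDeriv, mul_one,
      norm_exp_ofReal_mul, Complex.norm_real, Real.norm_eq_abs, Complex.norm_natCast]
  · exact ae_of_all _ fun s => (hb s).summable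
  · simp only [(hb _).tsum_eq]
    refine (integrable_logHankel_weight hβ1 hθ0 hθ1 L β |x|).congr (ae_of_all _ fun s => ?_)
    simp only [norm_hankelFun, ← Real.exp_add]
  · exact ae_of_all _ fun s => ((hexpC _).mul_left _).mul_right _

lemma tsum_wright_eq_logHankelIntegral {β θ L : ℝ} (hβ1 : β < 1) (hθ0 : π / 2 < θ) (hθ1 : θ ≤ π)
    (hL : 0 ≤ L) (x : ℝ) :
    ∑' k : ℕ, (-x) ^ k / ((Nat.factorial k : ℝ) * Real.Gamma (1 - β * (k + 1)))
      = π⁻¹ * (logHankelIntegral θ L fun w =>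
          hankelFun β w * Complex.exp (-x * Complex.exp (β * w))).im := by
  have h := (Complex.hasSum_im (hasSum_logHankelIntegral_wright hβ1 hθ0 hθ1 L x)).mul_left π⁻¹
  rw [← h.tsum_eq]
  refine tsum_congr fun k => ?_
  rw [Complex.im_ofReal_mul, logHankelIntegral_hankelFun_im hθ0 hθ1 hL]
  field_simp

lemma integral_exp_neg_mul_sin {p : ℂ} {c : ℝ} (hp : 0 < p.re) :
    ∫ x in Ioi (0 : ℝ), Complex.exp (-x * p) * (Real.sin (c * x) : ℂ) = c / (c ^ 2 + p ^ 2) := by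
  have hre : ∀ r : ℝ, (-p + r * Complex.I).re < 0 := by
    intro r
    simpa using hp
  have hne : ∀ r : ℝ, -p + r * Complex.I ≠ 0 := fun r h => by
    have := hre r
    rw [h] at this
    exact lt_irrefl _ this
  have hpt : ∀ x : ℝ, Complex.exp (-x * p) * (Real.sin (c * x) : ℂ)
      = (Complex.exp ((-p + (-c : ℝ) * Complex.I) * x)
          - Complex.exp ((-p + (c : ℝ) * Complex.I) * x)) * (Complex.I / 2) := by
    intro x
    rw [Complex.ofReal_sin, Complex.sin, mul_div_assoc', mul_div_assoc', ← mul_assoc, mul_sub,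
      ← Complex.exp_add, ← Complex.exp_add]
    push_cast
    congr 4 <;> ring_nf
  simp only [hpt]
  rw [integral_mul_const, integral_sub (integrableOn_exp_mul_complex_Ioi (hre _) 0)
    (integrableOn_exp_mul_complex_Ioi (hre _) 0), integral_exp_mul_complex_Ioi (hre _),
    integral_exp_mul_complex_Ioi (hre _)]
  have h1 := hne c
  have h2 := hne (-c)
  have h3 : (c : ℂ) ^ 2 + p ^ 2 = (-p + c * Complex.I) * (-p + (-c : ℝ) * Complex.I) := by
    push_cast
    linear_combination ((c : ℂ) ^ 2) * Complex.I_sq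
  rw [h3]
  simp only [Complex.ofReal_zero, mul_zero, Complex.exp_zero]
  have h4 : (-p + (-c : ℝ) * Complex.I) - (-p + c * Complex.I) = -2 * c * Complex.I := by
    push_cast
    ring
  generalize -p + c * Complex.I = A at h1 h4 ⊢
  generalize -p + (-c : ℝ) * Complex.I = B at h2 h4 ⊢
  field_simp
  linear_combination Complex.I * h4 - 2 * c * Complex.I_sq

lemma exp_mul_cos_le_re_exp_logHankel {β θ : ℝ} (hβ0 : 0 < β) (hθ : 0 ≤ θ)
    (hβθ : β * θ ≤ π / 2) {L s : ℝ} (hs : L - θ < s) :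
    rexp (β * L) * Real.cos (β * θ) ≤ (Complex.exp (β * logHankel θ L s)).re := by
  rw [Complex.exp_re, Complex.re_ofReal_mul, Complex.im_ofReal_mul, logHankel_re, logHankel_im]
  have h0 : 0 ≤ θ + min (s - L) 0 := by
    rcases min_cases (s - L) 0 with h | h <;> linarith
  have h1 : θ + min (s - L) 0 ≤ θ := by linarith [min_le_right (s - L) 0]
  have h2 : Real.cos (β * θ) ≤ Real.cos (β * (θ + min (s - L) 0)) :=
    Real.cos_le_cos_of_nonneg_of_le_pi (by positivity) (by linarith [Real.pi_pos]) (by gcongr)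
  have h3 : 0 ≤ Real.cos (β * θ) :=
    Real.cos_nonneg_of_neg_pi_div_two_le_of_le
      (by linarith [Real.pi_pos, mul_nonneg hβ0.le hθ]) hβθ
  gcongr
  exact le_max_right s L

lemma integral_logHankelIntegral_mul_sin {β θ : ℝ} (hβ0 : 0 < β) (hθ0 : π / 2 < θ)
    (hθ1 : θ ≤ π) (hβθ : β * θ < π / 2) (L c : ℝ) :
    ∫ x in Ioi (0 : ℝ), (logHankelIntegral θ L fun w =>
        hankelFun β w * Complex.exp (-x * Complex.exp (β * w))).im * Real.sin (c * x)
      = (logHankelIntegral θ L fun w =>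
        hankelFun β w * (c / (c ^ 2 + Complex.exp (β * w) ^ 2))).im := by
  have hθ : 0 ≤ θ := by linarith [Real.pi_pos]
  set κ := rexp (β * L) * Real.cos (β * θ) with hκ
  have hcos : 0 < Real.cos (β * θ) :=
    Real.cos_pos_of_mem_Ioo ⟨by nlinarith [Real.pi_pos], hβθ⟩
  have hκ0 : 0 < κ := by positivity
  set f : ℝ → ℝ → ℂ := fun x s => hankelFun β (logHankel θ L s)
    * Complex.exp (-x * Complex.exp (β * logHankel θ L s)) * logHankelDeriv L s
    * (Real.sin (c * x) : ℂ) with hf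
  have hint : Integrable (Function.uncurry f)
      ((volume.restrict (Ioi (0 : ℝ))).prod (volume.restrict (Ioi (L - θ)))) := by
    have hx : Integrable (fun x => rexp (-κ * x)) (volume.restrict (Ioi (0 : ℝ))) :=
      integrableOn_exp_mul_Ioi (by linarith) 0
    have hs := (integrable_hankelFun_logHankel hθ0 hθ1 L β).norm
    refine (hx.mul_prod hs).mono' ?_ ?_
    · have h1 : Continuous fun q : ℝ × ℝ => hankelFun β (logHankel θ L q.2) :=
        (continuous_hankelFun_logHankel θ L β).comp continuous_snd
      have h2 := continuous_logHankel θ L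
      have h3 := measurable_logHankelDeriv L
      have : Measurable (Function.uncurry f) := by
        simp only [hf, Function.uncurry_def]
        have h4 : Measurable fun q : ℝ × ℝ => hankelFun β (logHankel θ L q.2)
          * Complex.exp (-q.1 * Complex.exp (β * logHankel θ L q.2)) :=
          (by fun_prop : Continuous _).measurable
        have h5 : Measurable fun q : ℝ × ℝ => (Real.sin (c * q.1) : ℂ) :=
          (by fun_prop : Continuous _).measurable
        exact (h4.mul (h3.comp measurable_snd)).mul h5
      exact this.aestronglyMeasurable
    · rw [Measure.prod_restrict]
      filter_upwards [ae_restrict_mem (measurableSet_Ioi.prod measurableSet_Ioi)] with q hq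
      have hq1 : 0 < q.1 := hq.1
      have hre := exp_mul_cos_le_re_exp_logHankel hβ0 hθ hβθ.le (show L - θ < q.2 from hq.2)
      have hsin : ‖(Real.sin (c * q.1) : ℂ)‖ ≤ 1 := by
        rw [Complex.norm_real]
        exact Real.abs_sin_le_one _
      have hexp : ‖Complex.exp (-q.1 * Complex.exp (β * logHankel θ L q.2))‖
          ≤ rexp (-κ * q.1) := by
        rw [Complex.norm_exp, ← Complex.ofReal_neg, Complex.re_ofReal_mul, Real.exp_le_exp]
        nlinarith
      simp only [hf, Function.uncurry_def, norm_mul, norm_logHankelDeriv, mul_one]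
      calc _ ≤ ‖hankelFun β (logHankel θ L q.2)‖ * rexp (-κ * q.1) * 1 := by gcongr
        _ = _ := by ring
  have hinner : ∀ x : ℝ, ∫ s in Ioi (L - θ), f x s = (logHankelIntegral θ L fun w =>
      hankelFun β w * Complex.exp (-x * Complex.exp (β * w))) * (Real.sin (c * x) : ℂ) := by
    intro x
    simp only [hf, logHankelIntegral, integral_mul_const]
  have hleft := hint.integral_prod_left
  have him : ∀ x : ℝ, (∫ s in Ioi (L - θ), f x s).im = (logHankelIntegral θ L fun w =>
      hankelFun β w * Complex.exp (-x * Complex.exp (β * w))).im * Real.sin (c * x) := by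
    intro x
    rw [hinner, Complex.im_mul_ofReal]
  simp only [← him]
  have h1 : ∫ x in Ioi (0 : ℝ), (∫ s in Ioi (L - θ), f x s).im
      = (∫ x in Ioi (0 : ℝ), ∫ s in Ioi (L - θ), f x s).im := integral_im hleft
  rw [h1, integral_integral_swap hint, logHankelIntegral]
  congr 1
  refine setIntegral_congr_fun measurableSet_Ioi fun s hs => ?_
  have hre := exp_mul_cos_le_re_exp_logHankel hβ0 hθ hβθ.le (show L - θ < s from hs)
  rw [← integral_exp_neg_mul_sin (hκ0.trans_le hre), mul_right_comm, ← integral_const_mul]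
  refine integral_congr_ae (ae_of_all _ fun x => ?_)
  simp only [hf]
  ring

lemma hasSum_logHankelIntegral_sin {β θ : ℝ} (hβ0 : 0 < β) (hθ0 : π / 2 < θ)
    (hθ1 : θ ≤ π) {L c : ℝ} (hc0 : 0 ≤ c) (hc : c < rexp (β * L)) :
    HasSum (fun n : ℕ => (((-1) ^ n * c ^ (2 * n + 1) : ℝ) : ℂ)
        * logHankelIntegral θ L (hankelFun (-((2 * n + 1) * β))))
      (logHankelIntegral θ L fun w =>
        hankelFun β w * (c / (c ^ 2 + Complex.exp (β * w) ^ 2))) := by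
  have hF : ∀ (n : ℕ) (w : ℂ), (((-1) ^ n * c ^ (2 * n + 1) : ℝ) : ℂ)
      * hankelFun (-((2 * n + 1) * β)) w
      = hankelFun β w * (c / Complex.exp (β * w) ^ 2
          * (-(c / Complex.exp (β * w)) ^ 2) ^ n) := by
    intro n w
    have h1 : hankelFun β w
        = hankelFun (-((2 * n + 1) * β)) w * Complex.exp (β * w) ^ (2 * n + 2) := by
      rw [← Complex.exp_nat_mul]
      convert hankelFun_add (-((2 * n + 1) * β)) ((2 * n + 2) * β) w using 2
      · ring
      · push_cast
        ring_nf
    have h0 := Complex.exp_ne_zero (β * w)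
    rw [h1, neg_pow ((c / Complex.exp (β * w)) ^ 2), div_pow, div_pow, ← pow_mul, ← pow_mul]
    push_cast
    field_simp
    ring
  set E := rexp (β * L) with hE
  have hE0 : 0 < E := Real.exp_pos _
  have hw : ∀ s, E ≤ ‖Complex.exp (β * logHankel θ L s)‖ := by
    intro s
    rw [norm_exp_ofReal_mul, logHankel_re, hE]
    gcongr
    exact le_max_right s L
  have hq : (c / E) ^ 2 < 1 := by
    have : c / E < 1 := (div_lt_one hE0).2 hc
    have h0 : 0 ≤ c / E := by positivity
    nlinarith
  have hgeo := (hasSum_geometric_of_lt_one (sq_nonneg (c / E)) hq).mul_left (c / E ^ 2)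
  simp only [logHankelIntegral, ← integral_const_mul, ← mul_assoc, hF]
  have hb : ∀ s : ℝ, HasSum (fun n : ℕ => ‖hankelFun β (logHankel θ L s) * logHankelDeriv L s‖
      * (c / E ^ 2 * ((c / E) ^ 2) ^ n))
      (‖hankelFun β (logHankel θ L s) * logHankelDeriv L s‖
        * (c / E ^ 2 * (1 - (c / E) ^ 2)⁻¹)) :=
    fun s => hgeo.mul_left _
  refine hasSum_integral_of_dominated_convergence
    (fun n s => ‖hankelFun β (logHankel θ L s) * logHankelDeriv L s‖
      * (c / E ^ 2 * ((c / E) ^ 2) ^ n)) ?_ ?_ ?_ ?_ ?_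
  · intro n
    have h1 := continuous_hankelFun_logHankel θ L β
    have h2 := continuous_logHankel θ L
    have h3 : ∀ s, Complex.exp (β * logHankel θ L s) ≠ 0 := fun s => Complex.exp_ne_zero _
    have h4 : ∀ s, Complex.exp (β * logHankel θ L s) ^ 2 ≠ 0 := fun s => pow_ne_zero 2 (h3 s)
    exact (by fun_prop (disch := assumption) : Continuous _).aestronglyMeasurable.mul
      (measurable_logHankelDeriv L).aestronglyMeasurable
  · refine fun n => ae_of_all _ fun s => ?_
    simp only [norm_mul, norm_div, norm_pow, norm_neg, norm_logHankelDeriv, mul_one,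
      Complex.norm_real, Real.norm_eq_abs, abs_of_nonneg hc0, mul_assoc]
    gcongr <;> exact hw s
  · exact ae_of_all _ fun s => (hb s).summable
  · simp only [(hb _).tsum_eq]
    exact (integrable_hankelFun_logHankel hθ0 hθ1 L β).norm.mul_const _
  · refine ae_of_all _ fun s => ?_
    have h0 := Complex.exp_ne_zero (β * logHankel θ L s)
    set p := Complex.exp (β * logHankel θ L s) with hp
    have hlt : ‖-(c / p) ^ 2‖ < 1 := by
      rw [norm_neg, norm_pow, norm_div, Complex.norm_real, Real.norm_eq_abs, abs_of_nonneg hc0]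
      refine lt_of_le_of_lt ?_ hq
      gcongr
      exact hw s
    have hg := ((hasSum_geometric_of_norm_lt_one hlt).mul_left
      (hankelFun β (logHankel θ L s) * (c / p ^ 2))).mul_right (logHankelDeriv L s)
    have hval : c / p ^ 2 * (1 - -(c / p) ^ 2)⁻¹ = c / (c ^ 2 + p ^ 2) := by
      rw [sub_neg_eq_add, ← div_eq_mul_inv, div_div]
      congr 1
      field_simp
      ring
    rw [← hval, ← mul_assoc]
    exact hg

lemma rpow_two_mul_add_one_mul {t : ℝ} (ht : 0 < t) (β : ℝ) (n : ℕ) :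
    t ^ ((2 * (n : ℝ) + 1) * β) = (t ^ β) ^ (2 * n + 1) := by
  rw [← Real.rpow_natCast, ← Real.rpow_mul ht.le]
  congr 1
  push_cast
  ring

lemma mul_mittagLeffler_eq_tsum {t : ℝ} (ht : 0 < t) (β : ℝ) :
    t ^ β * mittagLeffler (2 * β) (β + 1) (-(t ^ (2 * β)))
      = ∑' n : ℕ, (-1 : ℝ) ^ n * t ^ ((2 * (n : ℝ) + 1) * β)
          / Real.Gamma ((2 * (n : ℝ) + 1) * β + 1) := by
  rw [mittagLeffler, ← tsum_mul_left]
  refine tsum_congr fun n => ?_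
  have h : t ^ (2 * β) = (t ^ β) ^ 2 := by
    rw [← Real.rpow_natCast, ← Real.rpow_mul ht.le]
    congr 1
    push_cast
    ring
  rw [rpow_two_mul_add_one_mul ht, h, neg_pow, ← pow_mul,
    show 2 * β * (n : ℝ) + (β + 1) = (2 * (n : ℝ) + 1) * β + 1 by ring]
  ring

lemma integral_wrightG_mul_sin {β t : ℝ} (hβ0 : 0 < β) (hβ1 : β < 1) (ht : 0 < t) :
    ∫ s in Ioi (0:ℝ), wrightG β s t * Real.sin s
      = ∑' n : ℕ, (-1 : ℝ) ^ n * t ^ ((2 * (n : ℝ) + 1) * β)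
          / Real.Gamma ((2 * (n : ℝ) + 1) * β + 1) := by
  obtain ⟨θ, hθ0, hθ⟩ : ∃ θ, π / 2 < θ ∧ θ < min π (π / 2 / β) := by
    refine exists_between (lt_min (by linarith [Real.pi_pos]) ?_)
    rw [lt_div_iff₀ hβ0]
    nlinarith [Real.pi_pos]
  have hθ1 : θ ≤ π := (hθ.trans_le (min_le_left _ _)).le
  have hβθ : β * θ < π / 2 := by
    have := hθ.trans_le (min_le_right _ _)
    rwa [lt_div_iff₀ hβ0, mul_comm] at this
  set c := t ^ β with hc
  have hc0 : 0 < c := Real.rpow_pos_of_pos ht β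
  obtain ⟨L, hL, hcL⟩ : ∃ L : ℝ, 0 ≤ L ∧ c < rexp (β * L) := by
    have h : Tendsto (fun L : ℝ => rexp (β * L)) atTop atTop :=
      Real.tendsto_exp_atTop.comp (tendsto_id.const_mul_atTop hβ0)
    exact ((eventually_ge_atTop 0).and (h.eventually_gt_atTop c)).exists
  have hscale := integral_comp_mul_left_Ioi (fun s => wrightG β s t * Real.sin s) 0 hc0
  rw [mul_zero, smul_eq_mul, eq_inv_mul_iff_mul_eq₀ hc0.ne', ← integral_const_mul] at hscale
  rw [← hscale]
  have hG : ∀ x : ℝ, c * (wrightG β (c * x) t * Real.sin (c * x))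
      = π⁻¹ * ((logHankelIntegral θ L fun w =>
          hankelFun β w * Complex.exp (-x * Complex.exp (β * w))).im * Real.sin (c * x)) := by
    intro x
    have hx : -(c * x) / c = -x := by field_simp
    rw [wrightG, ← hc, hx, tsum_wright_eq_logHankelIntegral hβ1 hθ0 hθ1 hL, Real.rpow_neg ht.le,
      ← hc]
    field_simp
  simp only [hG]
  rw [integral_const_mul, integral_logHankelIntegral_mul_sin hβ0 hθ0 hθ1 hβθ]
  have h := (Complex.hasSum_im (hasSum_logHankelIntegral_sin hβ0 hθ0 hθ1 hc0.le hcL)).mul_left π⁻¹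
  rw [← h.tsum_eq]
  refine tsum_congr fun n => ?_
  rw [Complex.im_ofReal_mul, logHankelIntegral_hankelFun_im hθ0 hθ1 hL,
    rpow_two_mul_add_one_mul ht, ← hc, sub_neg_eq_add, add_comm (1 : ℝ)]
  have := Real.pi_ne_zero
  field_simp

/-- Wright-type transform of sine:
`∫_0^∞ g_β(s;t) sin s ds = t^β E_{2β,β+1}(−t^{2β}) = ∑ (−1)^n t^{(2n+1)β}/Γ((2n+1)β+1)`. -/
theorem wrightTransform_sin (β t : ℝ) (hβ0 : 0 < β) (hβ1 : β < 1) (ht : 0 < t) :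
    (∫ s in Set.Ioi (0:ℝ), wrightG β s t * Real.sin s)
        = t ^ β * mittagLeffler (2 * β) (β + 1) (-(t ^ (2 * β))) ∧
      t ^ β * mittagLeffler (2 * β) (β + 1) (-(t ^ (2 * β)))
        = ∑' n : ℕ, (-1 : ℝ) ^ n * t ^ ((2 * (n : ℝ) + 1) * β)
            / Real.Gamma ((2 * (n : ℝ) + 1) * β + 1) :=
  ⟨(integral_wrightG_mul_sin hβ0 hβ1 ht).trans (mul_mittagLeffler_eq_tsum ht β).symm,
    mul_mittagLeffler_eq_tsum ht β⟩
end
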